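/- arXiv:2211.01690 — 13 statements merged into one kernel-verified Lean document; each statement's English description precedes it below -/
import Mathlib

section
/- Let k ≥ 1 be an integer and set N = 2k+5. Index the coordinates of ℤ^N by the set I = {E_1, F_1, …, E_k, F_k, A, D_0, E_0, F_0, B}, and let M : I × I → ℤ be the symmetric integer matrix whose only nonzero entries are (together with their transposes): M(E_i, E_i) = M(F_i, F_i) = −(12k+5), M(E_i, F_i) = 1, M(E_i, A) = M(F_i, A) = 1 for each 1 ≤ i ≤ k; M(A, A) = −1, M(A, D_0) = 1, M(A, B) = 1; M(D_0, D_0) = −3, M(D_0, E_0) = 1, M(D_0, F_0) = 1; M(E_0, E_0) = M(F_0, F_0) = −(4k+2); M(B, B) = −2. Then the cokernel ℤ^I / M(ℤ^I) of the ℤ-linear map defined by M is isomorphic, as an abelian group, to ℤ × (ℤ/(2k+1)ℤ) × (ℤ/24(2k+1)ℤ) × (ℤ/24(2k+1)(3k+1)ℤ)^(k−1). -/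
open Matrix

/-- Index type for the components `{E_1, F_1, …, E_k, F_k, A, D_0, E_0, F_0, B}`:
`.inl (i, false)` is `E_{i+1}`, `.inl (i, true)` is `F_{i+1}`, and
`.inr 0, .inr 1, .inr 2, .inr 3, .inr 4` are `A, D_0, E_0, F_0, B` respectively. -/
abbrev XnsIdx5 (k : ℕ) : Type := (Fin k × Bool) ⊕ Fin 5

/-- The intersection matrix of the special fiber of the minimal regular model with
normal crossings of `X_ns(p)` for `p = 12k+5`. -/
def xnsMat5 (k : ℕ) : Matrix (XnsIdx5 k) (XnsIdx5 k) ℤ :=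
  fun i j =>
    match i, j with
    | .inl (i, bi), .inl (j, bj) =>
        if i = j then (if bi = bj then -(12 * (k : ℤ) + 5) else 1) else 0
    | .inl _, .inr a => if a = 0 then 1 else 0
    | .inr a, .inl _ => if a = 0 then 1 else 0
    | .inr a, .inr b =>
        !![-1,  1,                   0,                   0,  1;
            1, -3,                   1,                   1,  0;
            0,  1, -(4 * (k : ℤ) + 2),                   0,  0;
            0,  1,                   0, -(4 * (k : ℤ) + 2),  0;
            1,  0,                   0,                   0, -2] a b

namespace XnsMat5

section Rows

variable {k : ℕ} (y : XnsIdx5 k → ℤ)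

lemma mulVec_E (i : Fin k) : (xnsMat5 k *ᵥ y) (.inl (i, false)) =
    -(12 * (k : ℤ) + 5) * y (.inl (i, false)) + y (.inl (i, true)) + y (.inr 0) := by
  simp [mulVec, dotProduct, Fintype.sum_prod_type, xnsMat5, ite_mul,
    Finset.sum_ite_eq]
  ring

lemma mulVec_F (i : Fin k) : (xnsMat5 k *ᵥ y) (.inl (i, true)) =
    y (.inl (i, false)) - (12 * (k : ℤ) + 5) * y (.inl (i, true)) + y (.inr 0) := by
  simp [mulVec, dotProduct, Fintype.sum_prod_type, xnsMat5, ite_mul,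
    Finset.sum_ite_eq]
  ring

lemma mulVec_A : (xnsMat5 k *ᵥ y) (.inr 0) =
    (∑ i, y (.inl (i, false)) + ∑ i, y (.inl (i, true))) - y (.inr 0) + y (.inr 1)
      + y (.inr 4) := by
  simp [mulVec, dotProduct, Fintype.sum_prod_type, xnsMat5, Finset.sum_add_distrib,
    Fin.sum_univ_five]
  ring

lemma mulVec_D₀ : (xnsMat5 k *ᵥ y) (.inr 1) =
    y (.inr 0) - 3 * y (.inr 1) + y (.inr 2) + y (.inr 3) := by
  simp [mulVec, dotProduct, xnsMat5, Fin.sum_univ_five]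
  ring

lemma mulVec_E₀ : (xnsMat5 k *ᵥ y) (.inr 2) =
    y (.inr 1) - (4 * (k : ℤ) + 2) * y (.inr 2) := by
  simp [mulVec, dotProduct, xnsMat5, Fin.sum_univ_five]
  ring

lemma mulVec_F₀ : (xnsMat5 k *ᵥ y) (.inr 3) =
    y (.inr 1) - (4 * (k : ℤ) + 2) * y (.inr 3) := by
  simp [mulVec, dotProduct, xnsMat5, Fin.sum_univ_five]
  ring

lemma mulVec_B : (xnsMat5 k *ᵥ y) (.inr 4) = y (.inr 0) - 2 * y (.inr 4) := by
  simp [mulVec, dotProduct, xnsMat5, Fin.sum_univ_five]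
  ring

end Rows

section Functionals

variable {k : ℕ}

/-- The pairing with the vector of multiplicities, which spans the kernel of `xnsMat5 k`. -/
def degree (x : XnsIdx5 k → ℤ) : ℤ :=
  (∑ i, x (.inl (i, false)) + ∑ i, x (.inl (i, true))) + (12 * k + 4) * x (.inr 0)
    + (4 * k + 2) * x (.inr 1) + x (.inr 2) + x (.inr 3) + (6 * k + 2) * x (.inr 4)

/-- A functional which is divisible by `2k+1` on the image of `xnsMat5 k`. -/
def tail (x : XnsIdx5 k → ℤ) : ℤ :=
  -2 * ∑ i, x (.inl (i, true)) + 2 * x (.inr 0) - 2 * x (.inr 3) + x (.inr 4)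

/-- The functional `E_i + p F_i`, where `p = 12k+5`. -/
def pair (i : Fin k) (x : XnsIdx5 k → ℤ) : ℤ :=
  x (.inl (i, false)) + (12 * k + 5) * x (.inl (i, true))

lemma degree_add (x y : XnsIdx5 k → ℤ) : degree (x + y) = degree x + degree y := by
  simp only [degree, Pi.add_apply, Finset.sum_add_distrib]; ring

lemma tail_add (x y : XnsIdx5 k → ℤ) : tail (x + y) = tail x + tail y := by
  simp only [tail, Pi.add_apply, Finset.sum_add_distrib]; ring

lemma pair_add (i : Fin k) (x y : XnsIdx5 k → ℤ) : pair i (x + y) = pair i x + pair i y := by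
  simp only [pair, Pi.add_apply]; ring

lemma degree_mulVec (y : XnsIdx5 k → ℤ) : degree (xnsMat5 k *ᵥ y) = 0 := by
  simp only [degree, mulVec_E, mulVec_F, mulVec_A, mulVec_D₀, mulVec_E₀, mulVec_F₀, mulVec_B,
    Finset.sum_add_distrib, Finset.sum_sub_distrib, ← Finset.mul_sum, Finset.sum_const,
    Finset.card_univ, Fintype.card_fin, nsmul_eq_mul]
  ring

lemma tail_mulVec (y : XnsIdx5 k → ℤ) : tail (xnsMat5 k *ᵥ y) =
    (2 * k + 1) * (12 * ∑ i, y (.inl (i, true)) - y (.inr 0) + 4 * y (.inr 3)) := by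
  simp only [tail, mulVec_F, mulVec_A, mulVec_F₀, mulVec_B,
    Finset.sum_add_distrib, Finset.sum_sub_distrib, ← Finset.mul_sum, Finset.sum_const,
    Finset.card_univ, Fintype.card_fin, nsmul_eq_mul]
  ring

lemma pair_mulVec (i : Fin k) (y : XnsIdx5 k → ℤ) : pair i (xnsMat5 k *ᵥ y) =
    6 * (2 * k + 1) * y (.inr 0)
      - 24 * (2 * k + 1) * (3 * k + 1) * y (.inl (i, true)) := by
  simp only [pair, mulVec_E, mulVec_F]
  ring

end Functionals

variable (n : ℕ)

/-- The homomorphism onto the product of cyclic groups whose kernel is the image of the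
intersection matrix. -/
def toCyclic : (XnsIdx5 (n + 1) → ℤ) →+ ℤ × ZMod (2 * (n + 1) + 1) ×
    ZMod (24 * (2 * (n + 1) + 1)) ×
      (Fin n → ZMod (24 * (2 * (n + 1) + 1) * (3 * (n + 1) + 1))) :=
  AddMonoidHom.mk' (fun x => (degree x, (tail x : ℤ), (pair 0 x + 6 * tail x : ℤ),
    fun j => (pair j.succ x - pair 0 x : ℤ))) fun x y => by
      ext
      · simp [degree_add]
      · simp [tail_add]
      · simp [tail_add, pair_add]; ring
      · simp [pair_add]; ring

variable {n}

lemma toCyclic_eq_zero_iff (x : XnsIdx5 (n + 1) → ℤ) : toCyclic n x = 0 ↔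
    degree x = 0 ∧ (2 * ((n + 1 : ℕ) : ℤ) + 1) ∣ tail x ∧
      24 * (2 * ((n + 1 : ℕ) : ℤ) + 1) ∣ pair 0 x + 6 * tail x ∧
      ∀ j : Fin n, 24 * (2 * ((n + 1 : ℕ) : ℤ) + 1) * (3 * ((n + 1 : ℕ) : ℤ) + 1) ∣
        pair j.succ x - pair 0 x := by
  simp only [toCyclic, AddMonoidHom.mk'_apply, Prod.ext_iff, funext_iff, Prod.fst_zero,
    Prod.snd_zero, Pi.zero_apply, ZMod.intCast_zmod_eq_zero_iff_dvd]
  push_cast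
  rfl

lemma toCyclic_mulVec (y : XnsIdx5 (n + 1) → ℤ) : toCyclic n (xnsMat5 (n + 1) *ᵥ y) = 0 := by
  rw [toCyclic_eq_zero_iff, degree_mulVec, tail_mulVec]
  simp only [pair_mulVec]
  refine ⟨trivial, dvd_mul_right _ _,
    ⟨3 * ∑ i, y (.inl (i, true)) + y (.inr 3)
      - (3 * ((n + 1 : ℕ) : ℤ) + 1) * y (.inl (0, true)), by ring⟩,
    fun j => ⟨y (.inl (0, true)) - y (.inl (j.succ, true)), by ring⟩⟩

lemma toCyclic_surjective : Function.Surjective (toCyclic n) := by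
  rintro ⟨t, u, s, g⟩
  obtain ⟨u, rfl⟩ := ZMod.intCast_surjective u
  obtain ⟨s, rfl⟩ := ZMod.intCast_surjective s
  choose h hh using fun j => ZMod.intCast_surjective (g j)
  obtain rfl : (fun j => (h j : ZMod _)) = g := funext hh
  let e : Fin (n + 1) → ℤ := Fin.cons (s - 6 * u) fun j => s - 6 * u + h j
  refine ⟨Sum.elim (fun q => if q.2 then 0 else e q.1)
    ![0, 0, t - ∑ i, e i - (6 * ((n + 1 : ℕ) : ℤ) + 2) * u, 0, u], ?_⟩
  simp [toCyclic, degree, tail, pair, e]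
  ring

lemma exists_mulVec_eq {x : XnsIdx5 (n + 1) → ℤ} (hx : toCyclic n x = 0) :
    ∃ y, xnsMat5 (n + 1) *ᵥ y = x := by
  obtain ⟨hd, ⟨α, hα⟩, ⟨β, hβ⟩, hγ⟩ := (toCyclic_eq_zero_iff x).1 hx
  choose γ hγ using hγ
  let w : Fin (n + 1) → ℤ := Fin.cons 0 fun j => -γ j
  let a : ℤ := 4 * β - α
  have hw (i : Fin (n + 1)) : pair i x = 6 * (2 * ((n + 1 : ℕ) : ℤ) + 1) * a
      - 24 * (2 * ((n + 1 : ℕ) : ℤ) + 1) * (3 * ((n + 1 : ℕ) : ℤ) + 1) * w i := by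
    have h0 : pair 0 x = 6 * (2 * ((n + 1 : ℕ) : ℤ) + 1) * a := by
      simp only [a]; linear_combination hβ - 6 * hα
    refine Fin.cases ?_ (fun j => ?_) i
    · simp [w, h0]
    · simp only [w, Fin.cons_succ]; linear_combination hγ j + h0
  have hsum := Finset.sum_congr rfl fun i (_ : i ∈ Finset.univ) => hw i
  clear_value w
  simp only [pair, Finset.sum_add_distrib, Finset.sum_sub_distrib, ← Finset.mul_sum,
    Finset.sum_const, Finset.card_univ, Fintype.card_fin, nsmul_eq_mul] at hsum
  simp only [pair] at hw
  simp only [degree] at hd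
  simp only [tail] at hα
  generalize hK : ((n + 1 : ℕ) : ℤ) = K at *
  let f₀ : ℤ := β - 3 * ∑ i, w i
  let d : ℤ := x (.inr 3) + (4 * K + 2) * f₀
  let b : ℤ := 2 * β -
    (x (.inr 4) - ∑ i, x (.inl (i, true)) + x (.inr 0) - x (.inr 3) - K * α)
  refine ⟨Sum.elim
    (fun q => if q.2 then w q.1 else x (.inl (q.1, true)) + (12 * K + 5) * w q.1 - a)
    ![a, d, x (.inr 1) - a + 3 * d - f₀, f₀, b], ?_⟩
  ext (⟨i, _ | _⟩ | j)
  · rw [mulVec_E, hK]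
    simp
    linear_combination -hw i
  · rw [mulVec_F, hK]
    simp
    ring
  · fin_cases j
    · refine (mulVec_A _).trans ?_
      simp [Finset.sum_add_distrib, Finset.sum_sub_distrib, ← Finset.mul_sum]
      push_cast at hK
      rw [hK]
      simp only [a, d, f₀, b]
      linear_combination -hα
    · refine (mulVec_D₀ _).trans ?_
      simp
      ring
    · refine (mulVec_E₀ _).trans ?_
      rw [hK]
      simp
      simp only [a, d, f₀] at *
      linear_combination hsum - hd + (6 * K + 2) * hα
    · refine (mulVec_F₀ _).trans ?_
      rw [hK]
      simp [d]
    · refine (mulVec_B _).trans ?_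
      simp [a, b]
      linear_combination hα

lemma range_mulVecLin_eq_ker :
    LinearMap.range (xnsMat5 (n + 1)).mulVecLin = LinearMap.ker (toCyclic n).toIntLinearMap := by
  ext x
  constructor
  · rintro ⟨y, rfl⟩
    exact toCyclic_mulVec y
  · exact exists_mulVec_eq

end XnsMat5

/-- The cokernel `ℤ^I / M(ℤ^I)` of the intersection matrix of the minimal regular model
with normal crossings of `X_ns(p)`, `p = 12k+5`, is isomorphic as an abelian group to
`ℤ × ℤ/(2k+1) × ℤ/24(2k+1) × (ℤ/24(2k+1)(3k+1))^(k-1)`. -/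
theorem cokernel_Xns_twelve_k_plus_five (k : ℕ) (hk : 1 ≤ k) :
    Nonempty (((XnsIdx5 k → ℤ) ⧸ LinearMap.range (Matrix.mulVecLin (xnsMat5 k))) ≃+
      (ℤ × ZMod (2 * k + 1) × ZMod (24 * (2 * k + 1)) ×
        (Fin (k - 1) → ZMod (24 * (2 * k + 1) * (3 * k + 1))))) := by
  obtain ⟨n, rfl⟩ := Nat.exists_eq_add_of_le' hk
  exact ⟨((Submodule.quotEquivOfEq _ _ XnsMat5.range_mulVecLin_eq_ker).trans
    ((XnsMat5.toCyclic n).toIntLinearMap.quotKerEquivOfSurjective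
      XnsMat5.toCyclic_surjective)).toAddEquiv⟩
end

section
/- Let k ≥ 2 be an integer and set N = 2k+3. Index the coordinates of ℤ^N by the set I = {E_1, F_1, …, E_k, F_k, A, B, C}, and let M : I × I → ℤ be the symmetric integer matrix whose only nonzero entries are (together with their transposes): M(E_i, E_i) = M(F_i, F_i) = −(12k+1), M(E_i, F_i) = 1, M(E_i, A) = M(F_i, A) = 1 for each 1 ≤ i ≤ k; M(A, A) = −1, M(A, B) = 1, M(A, C) = 1; M(B, B) = −2; M(C, C) = −3. Then the cokernel ℤ^I / M(ℤ^I) is isomorphic, as an abelian group, to ℤ × (ℤ/(6k+1)ℤ) × (ℤ/24(6k+1)ℤ) × (ℤ/24k(6k+1)ℤ)^(k−2). -/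
open Matrix

/-- Index type for the components `{E_1, F_1, …, E_k, F_k, A, B, C}`:
`.inl (i, false)` is `E_{i+1}`, `.inl (i, true)` is `F_{i+1}`, and
`.inr 0, .inr 1, .inr 2` are `A, B, C` respectively. -/
abbrev XnsIdx1 (k : ℕ) : Type := (Fin k × Bool) ⊕ Fin 3

/-- The intersection matrix of the special fiber of the minimal regular model with
normal crossings of `X_ns(p)` for `p = 12k+1`. -/
def xnsMat1 (k : ℕ) : Matrix (XnsIdx1 k) (XnsIdx1 k) ℤ :=
  fun i j =>
    match i, j with
    | .inl (i, bi), .inl (j, bj) =>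
        if i = j then (if bi = bj then -(12 * (k : ℤ) + 1) else 1) else 0
    | .inl _, .inr a => if a = 0 then 1 else 0
    | .inr a, .inl _ => if a = 0 then 1 else 0
    | .inr a, .inr b =>
        !![-1,  1,  1;
            1, -2,  0;
            1,  0, -3] a b

section Coordinates

variable {k : ℕ}

theorem xnsMat1_mulVec_inl_false (u : XnsIdx1 k → ℤ) (i : Fin k) :
    (xnsMat1 k).mulVec u (.inl (i, false)) =
      -(12 * (k : ℤ) + 1) * u (.inl (i, false)) + u (.inl (i, true)) + u (.inr 0) := by
  simp [Matrix.mulVec, dotProduct, xnsMat1, Fintype.sum_sum_type, Fintype.sum_prod_type]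
  ring

theorem xnsMat1_mulVec_inl_true (u : XnsIdx1 k → ℤ) (i : Fin k) :
    (xnsMat1 k).mulVec u (.inl (i, true)) =
      u (.inl (i, false)) - (12 * (k : ℤ) + 1) * u (.inl (i, true)) + u (.inr 0) := by
  simp [Matrix.mulVec, dotProduct, xnsMat1, Fintype.sum_sum_type, Fintype.sum_prod_type]
  ring

theorem xnsMat1_mulVec_inr_zero (u : XnsIdx1 k → ℤ) :
    (xnsMat1 k).mulVec u (.inr 0) =
      ∑ i, u (.inl (i, false)) + ∑ i, u (.inl (i, true))
        - u (.inr 0) + u (.inr 1) + u (.inr 2) := by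
  simp [Matrix.mulVec, dotProduct, xnsMat1, Fintype.sum_sum_type, Fintype.sum_prod_type,
    Fin.sum_univ_three, Finset.sum_add_distrib]
  ring

theorem xnsMat1_mulVec_inr_one (u : XnsIdx1 k → ℤ) :
    (xnsMat1 k).mulVec u (.inr 1) = u (.inr 0) - 2 * u (.inr 1) := by
  simp [Matrix.mulVec, dotProduct, xnsMat1, Fintype.sum_sum_type, Fin.sum_univ_three]
  ring

theorem xnsMat1_mulVec_inr_two (u : XnsIdx1 k → ℤ) :
    (xnsMat1 k).mulVec u (.inr 2) = u (.inr 0) - 3 * u (.inr 2) := by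
  simp [Matrix.mulVec, dotProduct, xnsMat1, Fintype.sum_sum_type, Fin.sum_univ_three]
  ring

/-- The coefficient of `B - C - 2 ∑ E_i` when `v` is rewritten in the cokernel in terms of the
classes of `B - C - 2 ∑ E_i` and of the `E_i`. -/
def xnsTau (v : XnsIdx1 k → ℤ) : ℤ :=
  6 * v (.inr 0) + 3 * v (.inr 1) + 2 * v (.inr 2) - 6 * ∑ i, v (.inl (i, true))

/-- The coefficient of `E_i` when `v` is rewritten in the cokernel in terms of the classes of
`B - C - 2 ∑ E_i` and of the `E_i`. -/
def xnsCoef (v : XnsIdx1 k → ℤ) (i : Fin k) : ℤ :=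
  v (.inl (i, false)) + (12 * k + 1) * v (.inl (i, true)) + 2 * xnsTau v

theorem xnsTau_add (v w : XnsIdx1 k → ℤ) : xnsTau (v + w) = xnsTau v + xnsTau w := by
  simp only [xnsTau, Pi.add_apply, Finset.sum_add_distrib]
  ring

theorem xnsCoef_add (v w : XnsIdx1 k → ℤ) (i : Fin k) :
    xnsCoef (v + w) i = xnsCoef v i + xnsCoef w i := by
  simp only [xnsCoef, xnsTau_add, Pi.add_apply]
  ring

theorem xnsTau_mulVec (u : XnsIdx1 k → ℤ) :
    xnsTau ((xnsMat1 k).mulVec u) =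
      (6 * k + 1) * (12 * ∑ i, u (.inl (i, true)) - u (.inr 0)) := by
  simp only [xnsTau, xnsMat1_mulVec_inl_true, xnsMat1_mulVec_inr_zero, xnsMat1_mulVec_inr_one,
    xnsMat1_mulVec_inr_two, Finset.sum_add_distrib, Finset.sum_sub_distrib, ← Finset.mul_sum,
    Finset.sum_const, Finset.card_univ, Fintype.card_fin, nsmul_eq_mul]
  ring

theorem xnsCoef_mulVec (u : XnsIdx1 k → ℤ) (i : Fin k) :
    xnsCoef ((xnsMat1 k).mulVec u) i =
      24 * (6 * k + 1) * (∑ j, u (.inl (j, true)) - k * u (.inl (i, true))) := by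
  simp only [xnsCoef, xnsTau_mulVec, xnsMat1_mulVec_inl_true, xnsMat1_mulVec_inl_false]
  ring

theorem mem_range_xnsMat1_iff (v : XnsIdx1 k → ℤ) :
    v ∈ LinearMap.range (Matrix.mulVecLin (xnsMat1 k)) ↔
      (6 * k + 1 : ℤ) ∣ xnsTau v ∧
        ∃ y : Fin k → ℤ, ∀ i, xnsCoef v i = 24 * (6 * k + 1) * (∑ j, y j - k * y i) := by
  constructor
  · rintro ⟨u, rfl⟩
    exact ⟨⟨_, xnsTau_mulVec u⟩, fun i => u (.inl (i, true)), xnsCoef_mulVec u⟩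
  · rintro ⟨⟨q, hq⟩, y, hy⟩
    set a : ℤ := 12 * ∑ j, y j - q with ha
    set x : Fin k → ℤ := fun i => v (.inl (i, true)) + (12 * k + 1) * y i - a with hx
    set r : ℤ := v (.inr 0) - ∑ i, x i - ∑ i, y i + a with hr
    set b : ℤ := 3 * r - 2 * a + v (.inr 1) + v (.inr 2) with hb
    have hsum : ∑ i, x i =
        ∑ i, v (.inl (i, true)) + (12 * k + 1) * ∑ i, y i - k * a := by
      simp [hx, Finset.sum_add_distrib, Finset.sum_sub_distrib, ← Finset.mul_sum]
    refine ⟨Sum.elim (fun p => if p.2 then y p.1 else x p.1) ![a, b, r - b], ?_⟩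
    funext j
    rw [Matrix.mulVecLin_apply]
    obtain ⟨i, _ | _⟩ | j := j
    · have h := hy i
      rw [xnsMat1_mulVec_inl_false]
      simp only [xnsCoef, hq] at h
      simp [hx]
      linear_combination -h + 2 * (6 * k + 1 : ℤ) * ha
    · rw [xnsMat1_mulVec_inl_true]
      simp [hx]
      ring
    · simp only [xnsTau] at hq
      fin_cases j
      · refine (xnsMat1_mulVec_inr_zero _).trans ?_
        simp [hr]
      · refine (xnsMat1_mulVec_inr_one _).trans ?_
        simp
        linear_combination -2 * hb - 6 * hr + 6 * hsum - hq - (6 * k + 1 : ℤ) * ha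
      · refine (xnsMat1_mulVec_inr_two _).trans ?_
        simp
        linear_combination 3 * hb + 6 * hr - 6 * hsum + hq + (6 * k + 1 : ℤ) * ha

end Coordinates

/-- The coordinates on the lattice `ℤ^(n+2)` adapted to the image of `(n+2) I - J`, where `J` is
the all-ones matrix. -/
theorem exists_eq_mul_sum_sub_iff {n : ℕ} (d : ℤ) (w : Fin (n + 2) → ℤ) :
    (∃ y : Fin (n + 2) → ℤ, ∀ i, w i = d * (∑ j, y j - (n + 2) * y i)) ↔
      ∑ i, w i = 0 ∧ d ∣ w 1 ∧ ∀ j : Fin n, d * (n + 2) ∣ w j.succ.succ - w 1 := by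
  constructor
  · rintro ⟨y, hy⟩
    refine ⟨?_, ⟨_, hy 1⟩, fun j => ⟨y 1 - y j.succ.succ, ?_⟩⟩
    · simp only [hy, ← Finset.mul_sum, Finset.sum_sub_distrib, Finset.sum_const,
        Finset.card_univ, Fintype.card_fin, nsmul_eq_mul]
      push_cast
      ring
    · rw [hy, hy]
      ring
  · rintro ⟨h0, ⟨p, hp⟩, hz⟩
    choose z hz using hz
    have hw (j : Fin n) : w j.succ.succ = d * p + d * (n + 2) * z j := by
      rw [← hz j, ← hp]
      ring
    have hw0 : w 0 = -(n + 1) * (d * p) - d * (n + 2) * ∑ j, z j := by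
      rw [Fin.sum_univ_succ, Fin.sum_univ_succ] at h0
      simp only [Fin.succ_zero_eq_one, hp, hw, Finset.sum_add_distrib, ← Finset.mul_sum,
        Finset.sum_const, Finset.card_univ, Fintype.card_fin, nsmul_eq_mul] at h0
      linear_combination h0
    have hsum : ∑ i, (Fin.cons (p + ∑ j, z j) (Fin.cons 0 fun j => -z j) : Fin (n + 2) → ℤ) i
        = p := by
      simp [Fin.sum_univ_succ]
    refine ⟨Fin.cons (p + ∑ j, z j) (Fin.cons 0 fun j => -z j), fun i => ?_⟩
    rw [hsum]
    refine Fin.cases ?_ (fun i => Fin.cases ?_ (fun j => ?_) i) i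
    · rw [hw0, Fin.cons_zero]
      ring
    · rw [Fin.succ_zero_eq_one, hp]
      rw [← Fin.succ_zero_eq_one, Fin.cons_succ, Fin.cons_zero]
      ring
    · rw [hw, Fin.cons_succ, Fin.cons_succ]
      ring

/-- The homomorphism from `ℤ^I` which identifies the cokernel of `xnsMat1 (n + 2)`. -/
def xnsHom (n : ℕ) : (XnsIdx1 (n + 2) → ℤ) →+
    (ℤ × ZMod (6 * (n + 2) + 1) × ZMod (24 * (6 * (n + 2) + 1)) ×
      (Fin n → ZMod (24 * (n + 2) * (6 * (n + 2) + 1)))) :=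
  AddMonoidHom.mk'
    (fun v => (∑ i, xnsCoef v i, (xnsTau v : ZMod _), (xnsCoef v 1 : ZMod _),
      fun j => ((xnsCoef v j.succ.succ - xnsCoef v 1 : ℤ) : ZMod _)))
    (fun v w => by
      ext
      · simp [xnsCoef_add, Finset.sum_add_distrib]
      · simp [xnsTau_add]
      · simp [xnsCoef_add]
      · simp [xnsCoef_add]
        ring)

theorem xnsHom_eq_zero_iff (n : ℕ) (v : XnsIdx1 (n + 2) → ℤ) :
    xnsHom n v = 0 ↔ v ∈ LinearMap.range (Matrix.mulVecLin (xnsMat1 (n + 2))) := by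
  have h := exists_eq_mul_sum_sub_iff (24 * (6 * (n + 2) + 1)) (xnsCoef v)
  rw [mem_range_xnsMat1_iff]
  push_cast
  rw [h]
  simp only [xnsHom, AddMonoidHom.mk'_apply, Prod.mk_eq_zero, funext_iff, Pi.zero_apply,
    ZMod.intCast_zmod_eq_zero_iff_dvd]
  push_cast
  rw [show (24 * (n + 2) * (6 * (n + 2) + 1) : ℤ) = 24 * (6 * (n + 2) + 1) * (n + 2) by ring]
  tauto

theorem xnsHom_surjective (n : ℕ) : Function.Surjective (xnsHom n) := by
  rintro ⟨s, t, c, d⟩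
  obtain ⟨t, rfl⟩ := ZMod.intCast_surjective t
  obtain ⟨c, rfl⟩ := ZMod.intCast_surjective c
  choose d' hd using fun j => ZMod.intCast_surjective (d j)
  obtain rfl : (fun j => (d' j : ZMod _)) = d := funext hd
  set w : Fin (n + 2) → ℤ :=
    Fin.cons (s - c - ∑ j, (c + d' j)) (Fin.cons c fun j => c + d' j) with hw
  set v : XnsIdx1 (n + 2) → ℤ :=
    Sum.elim (fun p => if p.2 then 0 else w p.1 - 2 * t) ![0, t, -t] with hv
  have htau : xnsTau v = t := by
    simp [xnsTau, hv]
    ring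
  have hcoef : xnsCoef v = w := by
    funext i
    rw [xnsCoef, htau]
    simp [hv]
  have hw1 : w 1 = c := by rw [hw, ← Fin.succ_zero_eq_one, Fin.cons_succ, Fin.cons_zero]
  refine ⟨v, ?_⟩
  simp only [xnsHom, AddMonoidHom.mk'_apply, hcoef, htau, hw1]
  ext
  · simp [hw, Fin.sum_univ_succ]
  · rfl
  · rfl
  · simp [hw]

/-- The cokernel `ℤ^I / M(ℤ^I)` of the intersection matrix of the minimal regular model
with normal crossings of `X_ns(p)`, `p = 12k+1`, is isomorphic as an abelian group to
`ℤ × ℤ/(6k+1) × ℤ/24(6k+1) × (ℤ/24k(6k+1))^(k-2)`. -/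
theorem cokernel_Xns_twelve_k_plus_one (k : ℕ) (hk : 2 ≤ k) :
    Nonempty (((XnsIdx1 k → ℤ) ⧸ LinearMap.range (Matrix.mulVecLin (xnsMat1 k))) ≃+
      (ℤ × ZMod (6 * k + 1) × ZMod (24 * (6 * k + 1)) ×
        (Fin (k - 2) → ZMod (24 * k * (6 * k + 1))))) := by
  obtain ⟨n, rfl⟩ := Nat.exists_eq_add_of_le' hk
  have hker : LinearMap.range (Matrix.mulVecLin (xnsMat1 (n + 2))) =
      LinearMap.ker (xnsHom n).toIntLinearMap := by
    ext v
    exact (xnsHom_eq_zero_iff n v).symm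
  exact ⟨((Submodule.quotEquivOfEq _ _ hker).trans
    ((xnsHom n).toIntLinearMap.quotKerEquivOfSurjective
      (xnsHom_surjective n))).toAddEquiv⟩
end

section
/- Let k ≥ 1 be an integer and set N = 2k+5. Index the coordinates of ℤ^N by the set I = {E_1, F_1, …, E_k, F_k, A, C, G, E', F'}, and let M : I × I → ℤ be the symmetric integer matrix whose only nonzero entries are (together with their transposes): M(E_i, E_i) = M(F_i, F_i) = −(12k+7), M(E_i, F_i) = 1, M(E_i, A) = M(F_i, A) = 1 for each 1 ≤ i ≤ k; M(A, A) = −1, M(A, C) = 1, M(A, G) = 1; M(C, C) = −3; M(G, G) = −2, M(G, E') = 1, M(G, F') = 1; M(E', E') = M(F', F') = −(6k+4). Then the cokernel ℤ^I / M(ℤ^I) is isomorphic, as an abelian group, to ℤ × (ℤ/(3k+2)ℤ) × (ℤ/24(3k+2)ℤ) × (ℤ/24(2k+1)(3k+2)ℤ)^(k−1). -/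
open Matrix

/-- Index type for the components `{E_1, F_1, …, E_k, F_k, A, C, G, E', F'}`:
`.inl (i, false)` is `E_{i+1}`, `.inl (i, true)` is `F_{i+1}`, and
`.inr 0, .inr 1, .inr 2, .inr 3, .inr 4` are `A, C, G, E', F'` respectively. -/
abbrev XnsIdx7 (k : ℕ) : Type := (Fin k × Bool) ⊕ Fin 5

/-- The intersection matrix of the special fiber of the minimal regular model with
normal crossings of `X_ns(p)` for `p = 12k+7`. -/
def xnsMat7 (k : ℕ) : Matrix (XnsIdx7 k) (XnsIdx7 k) ℤ :=
  fun i j =>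
    match i, j with
    | .inl (i, bi), .inl (j, bj) =>
        if i = j then (if bi = bj then -(12 * (k : ℤ) + 7) else 1) else 0
    | .inl _, .inr a => if a = 0 then 1 else 0
    | .inr a, .inl _ => if a = 0 then 1 else 0
    | .inr a, .inr b =>
        !![-1,  1,  1,                   0,                   0;
            1, -3,  0,                   0,                   0;
            1,  0, -2,                   1,                   1;
            0,  0,  1, -(6 * (k : ℤ) + 4),                   0;
            0,  0,  1,                   0, -(6 * (k : ℤ) + 4)] a b

section MulVec

variable {k : ℕ} (z : XnsIdx7 k → ℤ)

lemma xnsMat7_mulVec_E (i : Fin k) :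
    (xnsMat7 k *ᵥ z) (.inl (i, false)) =
      -(12 * (k : ℤ) + 7) * z (.inl (i, false)) + z (.inl (i, true)) + z (.inr 0) := by
  simp [Matrix.mulVec, dotProduct, xnsMat7, Fintype.sum_sum_type, Fintype.sum_prod_type]
  ring

lemma xnsMat7_mulVec_F (i : Fin k) :
    (xnsMat7 k *ᵥ z) (.inl (i, true)) =
      z (.inl (i, false)) - (12 * (k : ℤ) + 7) * z (.inl (i, true)) + z (.inr 0) := by
  simp [Matrix.mulVec, dotProduct, xnsMat7, Fintype.sum_sum_type, Fintype.sum_prod_type]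
  ring

lemma xnsMat7_mulVec_A :
    (xnsMat7 k *ᵥ z) (.inr 0) =
      ∑ i, z (.inl (i, false)) + ∑ i, z (.inl (i, true))
        - z (.inr 0) + z (.inr 1) + z (.inr 2) := by
  simp [Matrix.mulVec, dotProduct, xnsMat7, Fintype.sum_sum_type, Fintype.sum_prod_type,
    Finset.sum_add_distrib, Fin.sum_univ_five]
  ring

lemma xnsMat7_mulVec_C : (xnsMat7 k *ᵥ z) (.inr 1) = z (.inr 0) - 3 * z (.inr 1) := by
  simp [Matrix.mulVec, dotProduct, xnsMat7, Fintype.sum_sum_type, Fin.sum_univ_five]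
  ring

lemma xnsMat7_mulVec_G :
    (xnsMat7 k *ᵥ z) (.inr 2) = z (.inr 0) - 2 * z (.inr 2) + z (.inr 3) + z (.inr 4) := by
  simp [Matrix.mulVec, dotProduct, xnsMat7, Fintype.sum_sum_type, Fin.sum_univ_five]
  ring

lemma xnsMat7_mulVec_E' :
    (xnsMat7 k *ᵥ z) (.inr 3) = z (.inr 2) - (6 * (k : ℤ) + 4) * z (.inr 3) := by
  simp [Matrix.mulVec, dotProduct, xnsMat7, Fintype.sum_sum_type, Fin.sum_univ_five]
  ring

lemma xnsMat7_mulVec_F' :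
    (xnsMat7 k *ᵥ z) (.inr 4) = z (.inr 2) - (6 * (k : ℤ) + 4) * z (.inr 4) := by
  simp [Matrix.mulVec, dotProduct, xnsMat7, Fintype.sum_sum_type, Fin.sum_univ_five]
  ring

end MulVec

/-- The coefficient of `E_{i+1}` after `F_{i+1}` is eliminated by the relation of the row
of `E_{i+1}`. -/
def coeffE {k : ℕ} (i : Fin k) : (XnsIdx7 k → ℤ) →ₗ[ℤ] ℤ :=
  LinearMap.proj (.inl (i, false)) + (12 * (k : ℤ) + 7) • LinearMap.proj (.inl (i, true))

/-- The coefficient of `C` after every `F_i`, `A` and `F'` are eliminated. -/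
def coeffC (k : ℕ) : (XnsIdx7 k → ℤ) →ₗ[ℤ] ℤ :=
  (3 : ℤ) • LinearMap.proj (.inr 0) + LinearMap.proj (.inr 1)
    - (3 : ℤ) • ∑ i, LinearMap.proj (.inl (i, true)) - (3 : ℤ) • LinearMap.proj (.inr 4)

/-- The coordinate on the free part of the cokernel. -/
def coeffFree (k : ℕ) : (XnsIdx7 k → ℤ) →ₗ[ℤ] ℤ :=
  ∑ i, coeffE i + (4 * (k : ℤ) + 2) • coeffC k + (6 * (k : ℤ) + 4) • LinearMap.proj (.inr 2)
    + LinearMap.proj (.inr 3) + (12 * (k : ℤ) + 7) • LinearMap.proj (.inr 4)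

section Coefficients

variable {k : ℕ} (x : XnsIdx7 k → ℤ)

lemma coeffE_apply (i : Fin k) :
    coeffE i x = x (.inl (i, false)) + (12 * (k : ℤ) + 7) * x (.inl (i, true)) := rfl

lemma coeffC_apply :
    coeffC k x = 3 * x (.inr 0) + x (.inr 1) - 3 * ∑ i, x (.inl (i, true)) - 3 * x (.inr 4) := by
  simp [coeffC]

lemma coeffFree_apply :
    coeffFree k x = ∑ i, x (.inl (i, false)) + (12 * (k : ℤ) + 7) * ∑ i, x (.inl (i, true))
      + (4 * (k : ℤ) + 2) * coeffC k x + (6 * (k : ℤ) + 4) * x (.inr 2) + x (.inr 3)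
      + (12 * (k : ℤ) + 7) * x (.inr 4) := by
  simp [coeffFree, coeffE_apply, Finset.sum_add_distrib, Finset.mul_sum]

end Coefficients

section CoefficientsOfRange

variable {k : ℕ} (z : XnsIdx7 k → ℤ)

lemma coeffE_mulVec (i : Fin k) :
    coeffE i (xnsMat7 k *ᵥ z) =
      4 * (3 * (k : ℤ) + 2) * (z (.inr 0) - 6 * (2 * (k : ℤ) + 1) * z (.inl (i, true))) := by
  rw [coeffE_apply, xnsMat7_mulVec_E, xnsMat7_mulVec_F]
  ring

lemma coeffC_mulVec :
    coeffC k (xnsMat7 k *ᵥ z) =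
      (3 * (k : ℤ) + 2) * (12 * ∑ i, z (.inl (i, true)) - z (.inr 0) + 6 * z (.inr 4)) := by
  simp only [coeffC_apply, xnsMat7_mulVec_A, xnsMat7_mulVec_C, xnsMat7_mulVec_F,
    xnsMat7_mulVec_F', Finset.sum_add_distrib, Finset.sum_sub_distrib, ← Finset.mul_sum,
    Finset.sum_const, Finset.card_univ, Fintype.card_fin, nsmul_eq_mul]
  ring

lemma coeffFree_mulVec : coeffFree k (xnsMat7 k *ᵥ z) = 0 := by
  simp only [coeffFree_apply, coeffC_mulVec, xnsMat7_mulVec_E, xnsMat7_mulVec_F,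
    xnsMat7_mulVec_G, xnsMat7_mulVec_E', xnsMat7_mulVec_F', Finset.sum_add_distrib,
    Finset.sum_sub_distrib, ← Finset.mul_sum, Finset.sum_const, Finset.card_univ,
    Fintype.card_fin, nsmul_eq_mul]
  ring

end CoefficientsOfRange

lemma mem_range_xnsMat7 {k : ℕ} {x : XnsIdx7 k → ℤ} {r s : ℤ} {t : Fin k → ℤ}
    (hfree : coeffFree k x = 0) (hC : coeffC k x = (3 * k + 2) * r)
    (hE : ∀ i, coeffE i x = 4 * (3 * k + 2) * (6 * s - r + 6 * (2 * k + 1) * t i)) :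
    x ∈ LinearMap.range (Matrix.mulVecLin (xnsMat7 k)) := by
  set T := ∑ i, t i with hT
  set f : Fin k → ℤ := fun i => x (.inl (i, true)) with hf
  set a : ℤ := 6 * s - r with ha
  set v : ℤ := s + 2 * T with hv
  set g : ℤ := x (.inr 4) + (6 * k + 4) * v with hg
  set e : Fin k → ℤ := fun i => f i - (12 * k + 7) * t i - a with he
  have hsum : ∑ i, e i = ∑ i, f i - (12 * k + 7) * T - k * a := by
    simp [he, hT, Finset.sum_sub_distrib, Finset.mul_sum]
  have hEsum : ∑ i, x (.inl (i, false)) =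
      4 * (3 * k + 2) * (k * (6 * s - r) + 6 * (2 * k + 1) * T)
        - (12 * k + 7) * ∑ i, f i := by
    have h : ∑ i, coeffE i x
        = ∑ i, 4 * (3 * (k : ℤ) + 2) * (6 * s - r + 6 * (2 * k + 1) * t i) :=
      Finset.sum_congr rfl fun i _ => hE i
    simp only [coeffE_apply, Finset.sum_add_distrib, ← Finset.mul_sum, Finset.sum_const,
      Finset.card_univ, Fintype.card_fin, nsmul_eq_mul] at h
    linear_combination h
  rw [coeffFree_apply, hC, hEsum] at hfree
  rw [coeffC_apply] at hC
  let z : XnsIdx7 k → ℤ := Sum.elim (fun q => if q.2 then -t q.1 else e q.1)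
    ![a, x (.inr 0) + a - g - (∑ i, e i - T), g, x (.inr 2) - a + 2 * g - v, v]
  have zE (i) : z (.inl (i, false)) = e i := rfl
  have zF (i) : z (.inl (i, true)) = -t i := rfl
  have zA : z (.inr 0) = a := rfl
  have zC : z (.inr 1) = x (.inr 0) + a - g - (∑ i, e i - T) := rfl
  have zG : z (.inr 2) = g := rfl
  have zE' : z (.inr 3) = x (.inr 2) - a + 2 * g - v := rfl
  have zF' : z (.inr 4) = v := rfl
  refine ⟨z, ?_⟩
  rw [Matrix.mulVecLin_apply]
  funext j
  match j with
  | .inl (i, false) =>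
    have h := hE i
    rw [coeffE_apply] at h
    rw [xnsMat7_mulVec_E, zE, zF, zA]
    simp only [he, hf, ha]
    linear_combination -h
  | .inl (i, true) =>
    rw [xnsMat7_mulVec_F, zE, zF, zA]
    simp only [he, hf]
    ring
  | .inr 0 =>
    simp only [xnsMat7_mulVec_A, zE, zF, zA, zC, zG, Finset.sum_neg_distrib]
    ring
  | .inr 1 =>
    rw [xnsMat7_mulVec_C, zA, zC, hsum]
    simp only [hg, hv, ha]
    linear_combination -hC
  | .inr 2 =>
    rw [xnsMat7_mulVec_G, zA, zG, zE', zF']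
    ring
  | .inr 3 =>
    rw [xnsMat7_mulVec_E', zG, zE']
    simp only [hg, hv, ha]
    linear_combination -hfree
  | .inr 4 =>
    rw [xnsMat7_mulVec_F', zG, zF']
    simp only [hg]
    ring

/-- The homomorphism that identifies the cokernel of `xnsMat7 (n + 1)` with its decomposition
into cyclic groups. -/
def cokernelMap (n : ℕ) : (XnsIdx7 (n + 1) → ℤ) →+
    ℤ × ZMod (3 * (n + 1) + 2) × ZMod (24 * (3 * (n + 1) + 2)) ×
      (Fin n → ZMod (24 * (2 * (n + 1) + 1) * (3 * (n + 1) + 2))) :=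
  AddMonoidHom.mk'
    (fun x => (coeffFree (n + 1) x, ((coeffC (n + 1) x : ℤ) : ZMod _),
      ((coeffE 0 x + 4 * coeffC (n + 1) x : ℤ) : ZMod _),
      fun j => ((coeffE j.succ x - coeffE 0 x : ℤ) : ZMod _)))
    (fun x y => by
      ext <;> simp only [map_add, Prod.fst_add, Prod.snd_add, Pi.add_apply] <;>
        push_cast <;> ring)

lemma cokernelMap_apply (n : ℕ) (x : XnsIdx7 (n + 1) → ℤ) :
    cokernelMap n x = (coeffFree (n + 1) x, ((coeffC (n + 1) x : ℤ) : ZMod _),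
      ((coeffE 0 x + 4 * coeffC (n + 1) x : ℤ) : ZMod _),
      fun j => ((coeffE j.succ x - coeffE 0 x : ℤ) : ZMod _)) := rfl

lemma cokernelMap_eq_zero_iff (n : ℕ) (x : XnsIdx7 (n + 1) → ℤ) :
    cokernelMap n x = 0 ↔ coeffFree (n + 1) x = 0 ∧
      ((3 * (n + 1) + 2 : ℕ) : ℤ) ∣ coeffC (n + 1) x ∧
      ((24 * (3 * (n + 1) + 2) : ℕ) : ℤ) ∣ coeffE 0 x + 4 * coeffC (n + 1) x ∧
      ∀ j : Fin n, ((24 * (2 * (n + 1) + 1) * (3 * (n + 1) + 2) : ℕ) : ℤ) ∣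
        coeffE j.succ x - coeffE 0 x := by
  simp only [cokernelMap_apply, Prod.mk_eq_zero, funext_iff, Pi.zero_apply,
    CharP.intCast_eq_zero_iff (ZMod _)]

lemma ker_cokernelMap (n : ℕ) :
    (cokernelMap n).ker =
      (LinearMap.range (Matrix.mulVecLin (xnsMat7 (n + 1)))).toAddSubgroup := by
  ext x
  rw [AddMonoidHom.mem_ker, cokernelMap_eq_zero_iff, Submodule.mem_toAddSubgroup]
  constructor
  · rintro ⟨hfree, ⟨r, hr⟩, ⟨s, hs⟩, ht⟩
    choose t ht using ht
    push_cast at hr hs ht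
    refine mem_range_xnsMat7 (r := r) (s := s) (t := Fin.cons 0 t) hfree ?_ fun i => ?_
    · push_cast
      exact hr
    · induction i using Fin.cases with
      | zero =>
        push_cast [Fin.cons_zero]
        linear_combination hs - 4 * hr
      | succ j =>
        push_cast [Fin.cons_succ]
        linear_combination hs - 4 * hr + ht j
  · rintro ⟨z, rfl⟩
    simp only [Matrix.mulVecLin_apply, coeffFree_mulVec, coeffC_mulVec, coeffE_mulVec, true_and]
    push_cast
    refine ⟨dvd_mul_right _ _, ⟨2 * ∑ i, z (.inl (i, true)) + z (.inr 4)
      - (2 * ((n : ℤ) + 1) + 1) * z (.inl (0, true)), by ring⟩, fun j =>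
      ⟨z (.inl (0, true)) - z (.inl (j.succ, true)), by ring⟩⟩

lemma cokernelMap_surjective (n : ℕ) : Function.Surjective (cokernelMap n) := by
  rintro ⟨u, w, d, t⟩
  obtain ⟨w, rfl⟩ := ZMod.intCast_surjective w
  obtain ⟨d, rfl⟩ := ZMod.intCast_surjective d
  choose t' ht' using fun j => ZMod.intCast_surjective (t j)
  obtain rfl : (fun j => (t' j : ZMod _)) = t := funext ht'
  let y : Fin (n + 1) → ℤ := Fin.cons (d - 4 * w) fun j => t' j + (d - 4 * w)
  let x : XnsIdx7 (n + 1) → ℤ := Sum.elim (fun q => if q.2 then 0 else y q.1)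
    ![0, w, 0, u - ∑ i, y i - (4 * ((n + 1 : ℕ) : ℤ) + 2) * w, 0]
  have hE (i) : coeffE i x = y i := by simp [coeffE_apply, x]
  have hC : coeffC (n + 1) x = w := by simp [coeffC_apply, x]
  have hfree : coeffFree (n + 1) x = u := by
    rw [coeffFree_apply, hC]
    simp [x]
  refine ⟨x, ?_⟩
  rw [cokernelMap_apply, hC, hfree]
  simp [hE, y]

/-- The cokernel `ℤ^I / M(ℤ^I)` of the intersection matrix of the minimal regular model
with normal crossings of `X_ns(p)`, `p = 12k+7`, is isomorphic as an abelian group to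
`ℤ × ℤ/(3k+2) × ℤ/24(3k+2) × (ℤ/24(2k+1)(3k+2))^(k-1)`. -/
theorem cokernel_Xns_twelve_k_plus_seven (k : ℕ) (hk : 1 ≤ k) :
    Nonempty (((XnsIdx7 k → ℤ) ⧸ LinearMap.range (Matrix.mulVecLin (xnsMat7 k))) ≃+
      (ℤ × ZMod (3 * k + 2) × ZMod (24 * (3 * k + 2)) ×
        (Fin (k - 1) → ZMod (24 * (2 * k + 1) * (3 * k + 2))))) := by
  obtain ⟨n, rfl⟩ : ∃ n, k = n + 1 := ⟨k - 1, by omega⟩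
  exact ⟨(QuotientAddGroup.quotientAddEquivOfEq (ker_cokernelMap n).symm).trans
    (QuotientAddGroup.quotientKerEquivOfSurjective _ (cokernelMap_surjective n))⟩
end

section
/- Let k ≥ 0 be an integer and set N = 2k+7. Index the coordinates of ℤ^N by the set I = {E_1, F_1, …, E_k, F_k, A, G, E', F', D_0, E_0, F_0}, and let M : I × I → ℤ be the symmetric integer matrix whose only nonzero entries are (together with their transposes): M(E_i, E_i) = M(F_i, F_i) = −(12k+11), M(E_i, F_i) = 1, M(E_i, A) = M(F_i, A) = 1 for each 1 ≤ i ≤ k; M(A, A) = −1, M(A, G) = 1, M(A, D_0) = 1; M(G, G) = −2, M(G, E') = 1, M(G, F') = 1; M(E', E') = M(F', F') = −(6k+6); M(D_0, D_0) = −3, M(D_0, E_0) = 1, M(D_0, F_0) = 1; M(E_0, E_0) = M(F_0, F_0) = −(4k+4). Then the cokernel ℤ^I / M(ℤ^I) is isomorphic, as an abelian group, to ℤ × (ℤ/(k+1)ℤ) × (ℤ/24(k+1)ℤ) × (ℤ/24(k+1)(6k+5)ℤ)^k. -/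
open Matrix

/-- Index type for the components `{E_1, F_1, …, E_k, F_k, A, G, E', F', D_0, E_0, F_0}`:
`.inl (i, false)` is `E_{i+1}`, `.inl (i, true)` is `F_{i+1}`, and
`.inr 0, …, .inr 6` are `A, G, E', F', D_0, E_0, F_0` respectively. -/
abbrev XnsIdx11 (k : ℕ) : Type := (Fin k × Bool) ⊕ Fin 7

/-- The intersection matrix of the special fiber of the minimal regular model with
normal crossings of `X_ns(p)` for `p = 12k+11`. -/
def xnsMat11 (k : ℕ) : Matrix (XnsIdx11 k) (XnsIdx11 k) ℤ :=
  fun i j =>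
    match i, j with
    | .inl (i, bi), .inl (j, bj) =>
        if i = j then (if bi = bj then -(12 * (k : ℤ) + 11) else 1) else 0
    | .inl _, .inr a => if a = 0 then 1 else 0
    | .inr a, .inl _ => if a = 0 then 1 else 0
    | .inr a, .inr b =>
        !![-1,  1,                   0,                   0,  1,                   0,                   0;
            1, -2,                   1,                   1,  0,                   0,                   0;
            0,  1, -(6 * (k : ℤ) + 6),                   0,  0,                   0,                   0;
            0,  1,                   0, -(6 * (k : ℤ) + 6),  0,                   0,                   0;
            1,  0,                   0,                   0, -3,                   1,                   1;
            0,  0,                   0,                   0,  1, -(4 * (k : ℤ) + 4),                   0;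
            0,  0,                   0,                   0,  1,                   0, -(4 * (k : ℤ) + 4)] a b

/-- The coordinates of `xnsMat11 k *ᵥ y` at `E_i` and `F_i`. -/
theorem xnsMat11_mulVec_inl (k : ℕ) (y : XnsIdx11 k → ℤ) (i : Fin k) (b : Bool) :
    (xnsMat11 k *ᵥ y) (.inl (i, b)) =
      -(12 * (k : ℤ) + 11) * y (.inl (i, b)) + y (.inl (i, !b)) + y (.inr 0) := by
  cases b <;>
    simp [Matrix.mulVec, dotProduct, xnsMat11, Fintype.sum_sum_type, Fintype.sum_prod_type,
      ite_mul]
  ring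

/-- The coordinates of `xnsMat11 k *ᵥ y` at `A, G, E', F', D_0, E_0, F_0`. -/
theorem xnsMat11_mulVec_inr (k : ℕ) (y : XnsIdx11 k → ℤ) (a : Fin 7) :
    (xnsMat11 k *ᵥ y) (.inr a) =
      ![∑ i, (y (.inl (i, true)) + y (.inl (i, false))) - y (.inr 0) + y (.inr 1) + y (.inr 4),
        y (.inr 0) - 2 * y (.inr 1) + y (.inr 2) + y (.inr 3),
        y (.inr 1) - (6 * (k : ℤ) + 6) * y (.inr 2),
        y (.inr 1) - (6 * (k : ℤ) + 6) * y (.inr 3),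
        y (.inr 0) - 3 * y (.inr 4) + y (.inr 5) + y (.inr 6),
        y (.inr 4) - (4 * (k : ℤ) + 4) * y (.inr 5),
        y (.inr 4) - (4 * (k : ℤ) + 4) * y (.inr 6)] a := by
  fin_cases a <;>
    simp [Matrix.mulVec, dotProduct, xnsMat11, Fintype.sum_sum_type, Fintype.sum_prod_type,
      Fin.sum_univ_seven] <;> ring

/-- The pairing with the vector of multiplicities of the components. -/
def xnsDegree (k : ℕ) (v : XnsIdx11 k → ℤ) : ℤ :=
  ∑ i, v (.inl (i, false)) + ∑ i, v (.inl (i, true)) + (12 * k + 10) * v (.inr 0) +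
    (6 * k + 6) * v (.inr 1) + v (.inr 2) + v (.inr 3) + (4 * k + 4) * v (.inr 4) +
    v (.inr 5) + v (.inr 6)

/-- An integral lift of the projection of the cokernel to `ℤ/(k+1)`. -/
def xnsSmallCoord (k : ℕ) (v : XnsIdx11 k → ℤ) : ℤ :=
  v (.inr 0) - ∑ i, v (.inl (i, true)) - v (.inr 3) - v (.inr 6)

/-- An integral lift of the projection of the cokernel to `ℤ/24(k+1)`. -/
def xnsMidCoord (k : ℕ) (v : XnsIdx11 k → ℤ) : ℤ :=
  4 * v (.inr 0) - 4 * ∑ i, v (.inl (i, true)) - 4 * v (.inr 3) + (4 * k + 4) * v (.inr 4) +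
    v (.inr 5) + (12 * k + 7) * v (.inr 6)

/-- Integral lifts of the projections of the cokernel to the factors `ℤ/24(k+1)(6k+5)`. -/
def xnsLargeCoord (k : ℕ) (v : XnsIdx11 k → ℤ) (i : Fin k) : ℤ :=
  v (.inl (i, false)) + (12 * k + 11) * v (.inl (i, true)) - (12 * k + 12) * v (.inr 4) -
    3 * v (.inr 5) - (36 * k + 33) * v (.inr 6)

theorem xnsDegree_mulVec (k : ℕ) (y : XnsIdx11 k → ℤ) : xnsDegree k (xnsMat11 k *ᵥ y) = 0 := by
  simp [xnsDegree, xnsMat11_mulVec_inl, xnsMat11_mulVec_inr, Finset.sum_add_distrib,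
    ← Finset.mul_sum]
  ring

theorem xnsSmallCoord_mulVec (k : ℕ) (y : XnsIdx11 k → ℤ) :
    xnsSmallCoord k (xnsMat11 k *ᵥ y) =
      (k + 1) * (12 * ∑ i, y (.inl (i, true)) - y (.inr 0) + 6 * y (.inr 3) + 4 * y (.inr 6)) := by
  simp [xnsSmallCoord, xnsMat11_mulVec_inl, xnsMat11_mulVec_inr, Finset.sum_add_distrib,
    ← Finset.mul_sum]
  ring

theorem xnsMidCoord_mulVec (k : ℕ) (y : XnsIdx11 k → ℤ) :
    xnsMidCoord k (xnsMat11 k *ᵥ y) =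
      24 * (k + 1) * (2 * ∑ i, y (.inl (i, true)) + y (.inr 3) - (2 * k + 1) * y (.inr 6)) := by
  simp [xnsMidCoord, xnsMat11_mulVec_inl, xnsMat11_mulVec_inr, Finset.sum_add_distrib,
    ← Finset.mul_sum]
  ring

theorem xnsLargeCoord_mulVec (k : ℕ) (y : XnsIdx11 k → ℤ) (i : Fin k) :
    xnsLargeCoord k (xnsMat11 k *ᵥ y) i =
      24 * (k + 1) * (6 * k + 5) * (y (.inr 6) - y (.inl (i, true))) := by
  simp [xnsLargeCoord, xnsMat11_mulVec_inl, xnsMat11_mulVec_inr]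
  ring

/-- A vector whose coordinates are divisible by the orders of the corresponding factors lies in
the image of the intersection matrix. -/
theorem exists_xnsMat11_mulVec_eq (k : ℕ) (v : XnsIdx11 k → ℤ) (x w : ℤ) (t : Fin k → ℤ)
    (hd : xnsDegree k v = 0) (hx : xnsSmallCoord k v = (k + 1) * x)
    (hw : xnsMidCoord k v = 24 * (k + 1) * w)
    (ht : ∀ i, xnsLargeCoord k v i = 24 * (k + 1) * (6 * k + 5) * t i) :
    ∃ y, xnsMat11 k *ᵥ y = v := by
  simp only [xnsDegree, xnsSmallCoord, xnsMidCoord, xnsLargeCoord] at hd hx hw ht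
  have hT := Finset.sum_congr (rfl : (Finset.univ : Finset (Fin k)) = _) fun i _ => ht i
  simp only [Finset.sum_add_distrib, Finset.sum_sub_distrib, ← Finset.mul_sum, Finset.sum_const,
    Finset.card_univ, Fintype.card_fin, nsmul_eq_mul] at hT
  set s : ℤ := ∑ i, t i with hs
  set yF : ℤ := w + 2 * s
  set yA : ℤ := -12 * s + 6 * yF - x
  set yG : ℤ := v (.inr 3) + (6 * k + 6) * yF
  refine ⟨Sum.elim
    (fun ib => if ib.2 then -t ib.1 else v (.inl (ib.1, true)) - (12 * k + 11) * t ib.1 - yA)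
    ![yA, yG, v (.inr 1) - yA + 2 * yG - yF, yF, v (.inr 6), v (.inr 4) - yA + 3 * v (.inr 6), 0],
    ?_⟩
  ext (⟨i, b⟩ | a)
  · rw [xnsMat11_mulVec_inl]
    cases b
    · simp [yA, yF]
      linear_combination -ht i - 3 * hw + 12 * hx
    · simp
      ring
  · rw [xnsMat11_mulVec_inr]
    fin_cases a
    · simp [Finset.sum_add_distrib, Finset.sum_sub_distrib, ← Finset.mul_sum, ← hs, yG, yA, yF]
      linear_combination -hx
    · simp
      ring
    · simp [yG, yA, yF]
      linear_combination -hd + hT + (3 * k + 1) * hw + 6 * hx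
    · simp [yG]
    · simp
    · simp [yA, yF]
      linear_combination -hw + 4 * hx
    · simp

/-- The homomorphism inducing the isomorphism from the cokernel of the intersection matrix. -/
def xnsCoordHom (k : ℕ) : (XnsIdx11 k → ℤ) →+ (ℤ × ZMod (k + 1) × ZMod (24 * (k + 1)) ×
    (Fin k → ZMod (24 * (k + 1) * (6 * k + 5)))) where
  toFun v := (xnsDegree k v, (xnsSmallCoord k v : ZMod _), (xnsMidCoord k v : ZMod _),
    fun i => (xnsLargeCoord k v i : ZMod _))
  map_zero' := by
    ext <;> simp [xnsDegree, xnsSmallCoord, xnsMidCoord, xnsLargeCoord]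
  map_add' u v := by
    refine Prod.ext ?_ (Prod.ext ?_ (Prod.ext ?_ (funext fun i => ?_))) <;>
      simp only [Prod.fst_add, Prod.snd_add, Pi.add_apply, ← Int.cast_add] <;>
      [skip; congr 1; congr 1; congr 1] <;>
      simp only [xnsDegree, xnsSmallCoord, xnsMidCoord, xnsLargeCoord, Pi.add_apply,
        Finset.sum_add_distrib] <;> ring

theorem xnsCoordHom_surjective (k : ℕ) : Function.Surjective (xnsCoordHom k) := by
  rintro ⟨z, x, w, t⟩
  obtain ⟨x, rfl⟩ := ZMod.intCast_surjective x
  obtain ⟨w, rfl⟩ := ZMod.intCast_surjective w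
  choose t' ht' using fun i => ZMod.intCast_surjective (t i)
  obtain rfl : (fun i => (t' i : ZMod _)) = t := funext ht'
  refine ⟨Sum.elim (fun ib => if ib.2 then 0 else t' ib.1 + 3 * (w - 4 * x))
    ![x, 0, z - (∑ i, (t' i + 3 * (w - 4 * x)) + (12 * k + 10) * x + (w - 4 * x)), 0, 0,
      w - 4 * x, 0], ?_⟩
  refine Prod.ext ?_ (Prod.ext ?_ (Prod.ext ?_ (funext fun i => ?_))) <;>
    simp [xnsCoordHom, xnsDegree, xnsSmallCoord, xnsMidCoord, xnsLargeCoord]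
  ring

theorem range_mulVecLin_xnsMat11 (k : ℕ) :
    LinearMap.range (Matrix.mulVecLin (xnsMat11 k)) =
      LinearMap.ker (xnsCoordHom k).toIntLinearMap := by
  ext v
  simp only [LinearMap.mem_range, Matrix.mulVecLin_apply, LinearMap.mem_ker,
    AddMonoidHom.coe_toIntLinearMap]
  have key : xnsCoordHom k v = 0 ↔ xnsDegree k v = 0 ∧ ((k : ℤ) + 1) ∣ xnsSmallCoord k v ∧
      (24 * ((k : ℤ) + 1)) ∣ xnsMidCoord k v ∧
      ∀ i, (24 * ((k : ℤ) + 1) * (6 * k + 5)) ∣ xnsLargeCoord k v i := by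
    simp only [xnsCoordHom, AddMonoidHom.coe_mk, ZeroHom.coe_mk, Prod.mk_eq_zero, funext_iff,
      Pi.zero_apply, ZMod.intCast_zmod_eq_zero_iff_dvd]
    push_cast
    rfl
  rw [key]
  constructor
  · rintro ⟨y, rfl⟩
    exact ⟨xnsDegree_mulVec k y, ⟨_, xnsSmallCoord_mulVec k y⟩, ⟨_, xnsMidCoord_mulVec k y⟩,
      fun i => ⟨_, xnsLargeCoord_mulVec k y i⟩⟩
  · rintro ⟨hd, ⟨x, hx⟩, ⟨w, hw⟩, ht⟩
    choose t ht using ht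
    exact exists_xnsMat11_mulVec_eq k v x w t hd hx hw ht

/-- The cokernel `ℤ^I / M(ℤ^I)` of the intersection matrix of the minimal regular model
with normal crossings of `X_ns(p)`, `p = 12k+11`, is isomorphic as an abelian group to
`ℤ × ℤ/(k+1) × ℤ/24(k+1) × (ℤ/24(k+1)(6k+5))^k`. -/
theorem cokernel_Xns_twelve_k_plus_eleven (k : ℕ) :
    Nonempty (((XnsIdx11 k → ℤ) ⧸ LinearMap.range (Matrix.mulVecLin (xnsMat11 k))) ≃+
      (ℤ × ZMod (k + 1) × ZMod (24 * (k + 1)) ×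
        (Fin k → ZMod (24 * (k + 1) * (6 * k + 5))))) :=
  ⟨((Submodule.quotEquivOfEq _ _ (range_mulVecLin_xnsMat11 k)).trans
    ((xnsCoordHom k).toIntLinearMap.quotKerEquivOfSurjective
      (xnsCoordHom_surjective k))).toAddEquiv⟩
end

section
/- Let k ≥ 1 be an integer and set N = 2k+4. Index the coordinates of ℤ^N by the set I = {E_1, F_1, …, E_k, F_k, A, D_0, E_0, F_0}, and let M : I × I → ℤ be the symmetric integer matrix whose only nonzero entries are (together with their transposes): M(E_i, E_i) = −1, M(F_i, F_i) = −(12k+5), M(E_i, F_i) = 1, M(E_i, A) = M(F_i, A) = 1 for each 1 ≤ i ≤ k; M(A, A) = −(k+1), M(A, D_0) = 1; M(D_0, D_0) = −2, M(D_0, E_0) = 1, M(D_0, F_0) = 1; M(E_0, E_0) = −2; M(F_0, F_0) = −(4k+2). Then the cokernel ℤ^I / M(ℤ^I) is isomorphic, as an abelian group, to ℤ × (ℤ/4ℤ) × (ℤ/(12k+4)ℤ)^(k−1). -/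
open Matrix

/-- Index type for the components `{E_1, F_1, …, E_k, F_k, A, D_0, E_0, F_0}`:
`.inl (i, false)` is `E_{i+1}`, `.inl (i, true)` is `F_{i+1}`, and
`.inr 0, .inr 1, .inr 2, .inr 3` are `A, D_0, E_0, F_0` respectively. -/
abbrev XnsPlusIdx5 (k : ℕ) : Type := (Fin k × Bool) ⊕ Fin 4

/-- The intersection matrix of the special fiber of the minimal regular model with
normal crossings of `X_ns^+(p)` for `p = 12k+5`. -/
def xnsPlusMat5 (k : ℕ) : Matrix (XnsPlusIdx5 k) (XnsPlusIdx5 k) ℤ :=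
  fun i j =>
    match i, j with
    | .inl (i, bi), .inl (j, bj) =>
        if i = j then
          (if bi = bj then (if bi then -(12 * (k : ℤ) + 5) else -1) else 1)
        else 0
    | .inl _, .inr a => if a = 0 then 1 else 0
    | .inr a, .inl _ => if a = 0 then 1 else 0
    | .inr a, .inr b =>
        !![-((k : ℤ) + 1),  1,  0,                   0;
            1,             -2,  1,                   1;
            0,              1, -2,                   0;
            0,              1,  0, -(4 * (k : ℤ) + 2)] a b

theorem xnsPlusMat5_mulVec_E (k : ℕ) (u : XnsPlusIdx5 k → ℤ) (i : Fin k) :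
    (xnsPlusMat5 k *ᵥ u) (.inl (i, false)) =
      -u (.inl (i, false)) + u (.inl (i, true)) + u (.inr 0) := by
  simp [mulVec, dotProduct, xnsPlusMat5, Fintype.sum_prod_type]
  ring

theorem xnsPlusMat5_mulVec_F (k : ℕ) (u : XnsPlusIdx5 k → ℤ) (i : Fin k) :
    (xnsPlusMat5 k *ᵥ u) (.inl (i, true)) =
      u (.inl (i, false)) - (12 * k + 5) * u (.inl (i, true)) + u (.inr 0) := by
  simp [mulVec, dotProduct, xnsPlusMat5, Fintype.sum_prod_type]
  ring

theorem xnsPlusMat5_mulVec_A (k : ℕ) (u : XnsPlusIdx5 k → ℤ) :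
    (xnsPlusMat5 k *ᵥ u) (.inr 0) =
      ∑ i, u (.inl (i, false)) + ∑ i, u (.inl (i, true)) - (k + 1) * u (.inr 0) + u (.inr 1) := by
  simp [mulVec, dotProduct, xnsPlusMat5, Fintype.sum_prod_type, Fin.sum_univ_four,
    Finset.sum_add_distrib]
  ring

theorem xnsPlusMat5_mulVec_D (k : ℕ) (u : XnsPlusIdx5 k → ℤ) :
    (xnsPlusMat5 k *ᵥ u) (.inr 1) =
      u (.inr 0) - 2 * u (.inr 1) + u (.inr 2) + u (.inr 3) := by
  simp [mulVec, dotProduct, xnsPlusMat5, Fin.sum_univ_four]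
  ring

theorem xnsPlusMat5_mulVec_E₀ (k : ℕ) (u : XnsPlusIdx5 k → ℤ) :
    (xnsPlusMat5 k *ᵥ u) (.inr 2) = u (.inr 1) - 2 * u (.inr 2) := by
  simp [mulVec, dotProduct, xnsPlusMat5, Fin.sum_univ_four]
  ring

theorem xnsPlusMat5_mulVec_F₀ (k : ℕ) (u : XnsPlusIdx5 k → ℤ) :
    (xnsPlusMat5 k *ᵥ u) (.inr 3) = u (.inr 1) - (4 * k + 2) * u (.inr 3) := by
  simp [mulVec, dotProduct, xnsPlusMat5, Fin.sum_univ_four]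
  ring

/-- The pairing with the multiplicities of the components of the special fiber. -/
def xnsPlusDegree (k : ℕ) (v : XnsPlusIdx5 k → ℤ) : ℤ :=
  (6 * k + 3) * ∑ i, v (.inl (i, false)) + ∑ i, v (.inl (i, true)) + (6 * k + 2) * v (.inr 0) +
    (4 * k + 2) * v (.inr 1) + (2 * k + 1) * v (.inr 2) + v (.inr 3)

/-- An integral lift of the `ℤ/4`-coordinate on the cokernel. -/
def xnsPlusFour (k : ℕ) (v : XnsPlusIdx5 k → ℤ) : ℤ :=
  2 * ∑ i, v (.inl (i, false)) + 2 * v (.inr 0) + 2 * v (.inr 1) + v (.inr 2) + v (.inr 3)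

/-- An integral lift of the `ℤ/(12k+4)`-coordinate on the cokernel attached to the `i`-th
generic chain. -/
def xnsPlusChain (k : ℕ) (i : Fin k) (v : XnsPlusIdx5 k → ℤ) : ℤ :=
  v (.inl (i, false)) + v (.inl (i, true)) - 2 * v (.inr 1) - v (.inr 2) - 3 * v (.inr 3)

theorem xnsPlusDegree_mulVec (k : ℕ) (u : XnsPlusIdx5 k → ℤ) :
    xnsPlusDegree k (xnsPlusMat5 k *ᵥ u) = 0 := by
  simp only [xnsPlusDegree, xnsPlusMat5_mulVec_E, xnsPlusMat5_mulVec_F, xnsPlusMat5_mulVec_A,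
    xnsPlusMat5_mulVec_D, xnsPlusMat5_mulVec_E₀, xnsPlusMat5_mulVec_F₀, Finset.sum_add_distrib,
    Finset.sum_sub_distrib, Finset.sum_neg_distrib, ← Finset.mul_sum, Finset.sum_const,
    Finset.card_univ, Fintype.card_fin, nsmul_eq_mul]
  ring

theorem four_dvd_xnsPlusFour_mulVec (k : ℕ) (u : XnsPlusIdx5 k → ℤ) :
    4 ∣ xnsPlusFour k (xnsPlusMat5 k *ᵥ u) := by
  refine ⟨∑ i, u (.inl (i, true)) - k * u (.inr 3), ?_⟩
  simp only [xnsPlusFour, xnsPlusMat5_mulVec_E, xnsPlusMat5_mulVec_A,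
    xnsPlusMat5_mulVec_D, xnsPlusMat5_mulVec_E₀, xnsPlusMat5_mulVec_F₀, Finset.sum_add_distrib,
    Finset.sum_neg_distrib, Finset.sum_const,
    Finset.card_univ, Fintype.card_fin, nsmul_eq_mul]
  ring

theorem dvd_xnsPlusChain_mulVec (k : ℕ) (i : Fin k) (u : XnsPlusIdx5 k → ℤ) :
    (12 * k + 4 : ℤ) ∣ xnsPlusChain k i (xnsPlusMat5 k *ᵥ u) := by
  refine ⟨u (.inr 3) - u (.inl (i, true)), ?_⟩
  simp only [xnsPlusChain, xnsPlusMat5_mulVec_E, xnsPlusMat5_mulVec_F,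
    xnsPlusMat5_mulVec_D, xnsPlusMat5_mulVec_E₀, xnsPlusMat5_mulVec_F₀]
  ring

theorem sum_xnsPlusChain (k : ℕ) (v : XnsPlusIdx5 k → ℤ) :
    ∑ i, xnsPlusChain k i v = xnsPlusDegree k v - (3 * k + 1) * xnsPlusFour k v := by
  simp only [xnsPlusChain, xnsPlusDegree, xnsPlusFour, Finset.sum_add_distrib,
    Finset.sum_sub_distrib, Finset.sum_const, Finset.card_univ, Fintype.card_fin, nsmul_eq_mul]
  ring

theorem exists_mulVec_eq_of_dvd (k : ℕ) (v : XnsPlusIdx5 k → ℤ) (hdeg : xnsPlusDegree k v = 0)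
    (hfour : 4 ∣ xnsPlusFour k v) (hchain : ∀ i, (12 * k + 4 : ℤ) ∣ xnsPlusChain k i v) :
    ∃ u, xnsPlusMat5 k *ᵥ u = v := by
  obtain ⟨b, hb⟩ := hfour
  choose c hc using hchain
  have hsum : ∑ i, c i = -b := by
    have h := sum_xnsPlusChain k v
    simp only [hc, ← Finset.mul_sum, hdeg, hb] at h
    have h0 : (12 * k + 4 : ℤ) ≠ 0 := by positivity
    apply mul_left_cancel₀ h0
    linarith
  simp only [xnsPlusFour] at hb
  simp only [xnsPlusChain] at hc
  -- The solution normalized to vanish at `F_0`.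
  let e := v (.inr 3) -
    (2 * b - ∑ i, v (.inl (i, false)) - v (.inr 0) - v (.inr 1))
  let a := v (.inr 1) + 2 * v (.inr 3) - e
  refine ⟨Sum.elim (fun x => bif x.2 then -c x.1 else -c x.1 + a - v (.inl (x.1, false)))
    ![a, v (.inr 3), e, 0], ?_⟩
  ext (⟨i, _ | _⟩ | j)
  · simp [xnsPlusMat5_mulVec_E]
    ring
  · have := hc i
    simp [xnsPlusMat5_mulVec_F, a, e]
    linarith
  · fin_cases j
    · simp [xnsPlusMat5_mulVec_A, Finset.sum_add_distrib, Finset.sum_sub_distrib, hsum, a, e]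
      linarith
    · simp [xnsPlusMat5_mulVec_D, a]
      ring
    · simp [xnsPlusMat5_mulVec_E₀, e]
      linarith
    · simp [xnsPlusMat5_mulVec_F₀]

/-- The homomorphism inducing the isomorphism on the cokernel. The first generic chain is left
out, its coordinate being determined by the others. -/
def xnsPlusCokernelMap (m : ℕ) : (XnsPlusIdx5 (m + 1) → ℤ) →+
    ℤ × ZMod 4 × (Fin m → ZMod (12 * (m + 1) + 4)) where
  toFun v := (xnsPlusDegree _ v, (xnsPlusFour _ v : ℤ), fun j => (xnsPlusChain _ j.succ v : ℤ))
  map_zero' := by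
    ext <;> simp [xnsPlusDegree, xnsPlusFour, xnsPlusChain]
  map_add' v w := by
    ext <;> simp [xnsPlusDegree, xnsPlusFour, xnsPlusChain, Finset.sum_add_distrib] <;> ring

theorem xnsPlusCokernelMap_eq_zero_iff (m : ℕ) (v : XnsPlusIdx5 (m + 1) → ℤ) :
    xnsPlusCokernelMap m v = 0 ↔ xnsPlusDegree _ v = 0 ∧ 4 ∣ xnsPlusFour _ v ∧
      ∀ j : Fin m, (12 * (m + 1 : ℕ) + 4 : ℤ) ∣ xnsPlusChain _ j.succ v := by
  have hn : (12 * (m + 1 : ℕ) + 4 : ℤ) = (12 * (m + 1) + 4 : ℕ) := by push_cast; ring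
  rw [hn]
  simp only [xnsPlusCokernelMap, AddMonoidHom.coe_mk, ZeroHom.coe_mk, Prod.mk_eq_zero,
    funext_iff, Pi.zero_apply, ZMod.intCast_zmod_eq_zero_iff_dvd]
  rfl

theorem xnsPlusCokernelMap_ker (m : ℕ) :
    LinearMap.range (mulVecLin (xnsPlusMat5 (m + 1))) =
      LinearMap.ker (xnsPlusCokernelMap m).toIntLinearMap := by
  ext v
  simp only [LinearMap.mem_range, mulVecLin_apply, LinearMap.mem_ker,
    AddMonoidHom.coe_toIntLinearMap, xnsPlusCokernelMap_eq_zero_iff]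
  constructor
  · rintro ⟨u, rfl⟩
    exact ⟨xnsPlusDegree_mulVec _ u, four_dvd_xnsPlusFour_mulVec _ u,
      fun j => dvd_xnsPlusChain_mulVec _ _ u⟩
  · rintro ⟨hdeg, hfour, hchain⟩
    refine exists_mulVec_eq_of_dvd _ v hdeg hfour (Fin.cases ?_ hchain)
    have h := sum_xnsPlusChain _ v
    obtain ⟨b, hb⟩ := hfour
    rw [Fin.sum_univ_succ, hdeg, hb] at h
    rw [eq_sub_of_add_eq h]
    exact dvd_sub ⟨-b, by ring⟩ (Finset.dvd_sum fun j _ => hchain j)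

theorem xnsPlusCokernelMap_surjective (m : ℕ) : Function.Surjective (xnsPlusCokernelMap m) := by
  rintro ⟨g, t, h⟩
  obtain ⟨t, rfl⟩ := ZMod.intCast_surjective t
  choose c hc using fun j => ZMod.intCast_surjective (h j)
  refine ⟨Sum.elim (fun x => bif x.2 then
    Fin.cons (α := fun _ => ℤ) (g - ∑ j, (c j + t) - (2 * (m + 1 : ℕ) + 1) * t) (fun j => c j + t) x.1 else 0)
    ![0, 0, t, 0], ?_⟩
  ext j
  · simp [xnsPlusCokernelMap, xnsPlusDegree, Fin.sum_univ_succ]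
    ring
  · simp [xnsPlusCokernelMap, xnsPlusFour]
  · simp [xnsPlusCokernelMap, xnsPlusChain, hc]

/-- The cokernel `ℤ^I / M(ℤ^I)` of the intersection matrix of the minimal regular model
with normal crossings of `X_ns^+(p)`, `p = 12k+5`, is isomorphic as an abelian group to
`ℤ × ℤ/4 × (ℤ/(12k+4))^(k-1)`. -/
theorem cokernel_XnsPlus_twelve_k_plus_five (k : ℕ) (hk : 1 ≤ k) :
    Nonempty (((XnsPlusIdx5 k → ℤ) ⧸ LinearMap.range (Matrix.mulVecLin (xnsPlusMat5 k))) ≃+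
      (ℤ × ZMod 4 × (Fin (k - 1) → ZMod (12 * k + 4)))) := by
  obtain ⟨m, rfl⟩ := Nat.exists_eq_add_of_le' hk
  exact ⟨((Submodule.quotEquivOfEq _ _ (xnsPlusCokernelMap_ker m)).trans
    ((xnsPlusCokernelMap m).toIntLinearMap.quotKerEquivOfSurjective
      (xnsPlusCokernelMap_surjective m))).toAddEquiv⟩
end

section
/- Let k ≥ 2 be an integer and set N = 2k+3. Index the coordinates of ℤ^N by the set I = {E_1, F_1, …, E_k, F_k, A, C, C'}, and let M : I × I → ℤ be the symmetric integer matrix whose only nonzero entries are (together with their transposes): M(E_i, E_i) = −1, M(F_i, F_i) = −(12k+1), M(E_i, F_i) = 1, M(E_i, A) = M(F_i, A) = 1 for each 1 ≤ i ≤ k; M(A, A) = −(k+1), M(A, C) = 1; M(C, C) = −2, M(C, C') = 1; M(C', C') = −2. Then the cokernel ℤ^I / M(ℤ^I) is isomorphic, as an abelian group, to ℤ × (ℤ/12ℤ) × (ℤ/12kℤ)^(k−2). -/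
open Matrix

/-- Index type for the components `{E_1, F_1, …, E_k, F_k, A, C, C'}`:
`.inl (i, false)` is `E_{i+1}`, `.inl (i, true)` is `F_{i+1}`, and
`.inr 0, .inr 1, .inr 2` are `A, C, C'` respectively. -/
abbrev XnsPlusIdx1 (k : ℕ) : Type := (Fin k × Bool) ⊕ Fin 3

/-- The intersection matrix of the special fiber of the minimal regular model with
normal crossings of `X_ns^+(p)` for `p = 12k+1`. -/
def xnsPlusMat1 (k : ℕ) : Matrix (XnsPlusIdx1 k) (XnsPlusIdx1 k) ℤ :=
  fun i j =>
    match i, j with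
    | .inl (i, bi), .inl (j, bj) =>
        if i = j then
          (if bi = bj then (if bi then -(12 * (k : ℤ) + 1) else -1) else 1)
        else 0
    | .inl _, .inr a => if a = 0 then 1 else 0
    | .inr a, .inl _ => if a = 0 then 1 else 0
    | .inr a, .inr b =>
        !![-((k : ℤ) + 1),  1,  0;
            1,             -2,  1;
            0,              1, -2] a b

section XnsPlus

variable {k : ℕ} (y : XnsPlusIdx1 k → ℤ)

lemma xnsPlusMat1_mulVec_E (i : Fin k) : (xnsPlusMat1 k *ᵥ y) (.inl (i, false)) =
    -y (.inl (i, false)) + y (.inl (i, true)) + y (.inr 0) := by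
  simp [Matrix.mulVec, dotProduct, Fintype.sum_prod_type, xnsPlusMat1, ite_mul]
  ring

lemma xnsPlusMat1_mulVec_F (i : Fin k) : (xnsPlusMat1 k *ᵥ y) (.inl (i, true)) =
    y (.inl (i, false)) - (12 * k + 1) * y (.inl (i, true)) + y (.inr 0) := by
  simp [Matrix.mulVec, dotProduct, Fintype.sum_prod_type, xnsPlusMat1, ite_mul]
  ring

lemma xnsPlusMat1_mulVec_A : (xnsPlusMat1 k *ᵥ y) (.inr 0) =
    ∑ i, y (.inl (i, false)) + ∑ i, y (.inl (i, true)) - (k + 1) * y (.inr 0) + y (.inr 1) := by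
  simp [Matrix.mulVec, dotProduct, Fintype.sum_prod_type, Fin.sum_univ_three, xnsPlusMat1,
    Finset.sum_add_distrib]
  ring

lemma xnsPlusMat1_mulVec_C : (xnsPlusMat1 k *ᵥ y) (.inr 1) =
    y (.inr 0) - 2 * y (.inr 1) + y (.inr 2) := by
  simp [Matrix.mulVec, dotProduct, Fin.sum_univ_three, xnsPlusMat1]
  ring

lemma xnsPlusMat1_mulVec_C' : (xnsPlusMat1 k *ᵥ y) (.inr 2) = y (.inr 1) - 2 * y (.inr 2) := by
  simp [Matrix.mulVec, dotProduct, Fin.sum_univ_three, xnsPlusMat1]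
  ring

end XnsPlus

/-- The map `ℤ^I → ℤ × ℤ/12 × (ℤ/12k)^(k-2)`, for `k = m + 2`, which induces the isomorphism
from the cokernel of `xnsPlusMat1 k`. -/
def xnsPlusCokerHom (m : ℕ) : (XnsPlusIdx1 (m + 2) → ℤ) →ₗ[ℤ]
    ℤ × ZMod 12 × (Fin m → ZMod (12 * (m + 2))) :=
  AddMonoidHom.toIntLinearMap <| AddMonoidHom.mk'
    (fun x =>
      (∑ i, x (.inl (i, false)) + ∑ i, x (.inl (i, true)) +
          (m + 2) * (6 * ∑ i, x (.inl (i, false)) + 6 * x (.inr 0) + 4 * x (.inr 1)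
            + 2 * x (.inr 2)),
        ((x (.inl (0, false)) + x (.inl (0, true)) + 6 * ∑ i, x (.inl (i, false))
          + 6 * x (.inr 0) + 4 * x (.inr 1) + 2 * x (.inr 2) : ℤ) : ZMod 12),
        fun j => ((x (.inl (j.succ.succ, false)) + x (.inl (j.succ.succ, true))
          - x (.inl (0, false)) - x (.inl (0, true)) : ℤ) : ZMod (12 * (m + 2)))))
    (by
      intro x y
      refine Prod.ext ?_ (Prod.ext ?_ (funext fun j => ?_))
      · simp [Finset.sum_add_distrib]
        ring
      · simp [Finset.sum_add_distrib]
        ring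
      · simp
        ring)

lemma xnsPlusCokerHom_eq_zero_iff {m : ℕ} {x : XnsPlusIdx1 (m + 2) → ℤ} :
    xnsPlusCokerHom m x = 0 ↔
      ∑ i, x (.inl (i, false)) + ∑ i, x (.inl (i, true)) +
          (m + 2) * (6 * ∑ i, x (.inl (i, false)) + 6 * x (.inr 0) + 4 * x (.inr 1)
            + 2 * x (.inr 2)) = 0 ∧
      (12 : ℤ) ∣ x (.inl (0, false)) + x (.inl (0, true)) + 6 * ∑ i, x (.inl (i, false))
          + 6 * x (.inr 0) + 4 * x (.inr 1) + 2 * x (.inr 2) ∧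
      ∀ j : Fin m, (12 * (m + 2) : ℤ) ∣ x (.inl (j.succ.succ, false))
        + x (.inl (j.succ.succ, true)) - x (.inl (0, false)) - x (.inl (0, true)) := by
  have h12 (z : ℤ) : (z : ZMod 12) = 0 ↔ (12 : ℤ) ∣ z := ZMod.intCast_zmod_eq_zero_iff_dvd z 12
  have hk (z : ℤ) : (z : ZMod (12 * (m + 2))) = 0 ↔ (12 * (m + 2) : ℤ) ∣ z := by
    rw [ZMod.intCast_zmod_eq_zero_iff_dvd]
    push_cast
    rfl
  simp only [← h12, ← hk]
  exact Prod.ext_iff.trans (and_congr_right' (Prod.ext_iff.trans (and_congr_right' funext_iff)))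

lemma xnsPlusCokerHom_surjective (m : ℕ) : Function.Surjective (xnsPlusCokerHom m) := by
  rintro ⟨z, w, v⟩
  obtain ⟨w, rfl⟩ := ZMod.intCast_surjective w
  choose v' hv using fun j => ZMod.intCast_surjective (v j)
  obtain rfl : (fun j => (v' j : ZMod (12 * (m + 2)))) = v := funext hv
  let f : Fin (m + 2) → ℤ :=
    Fin.cons w (Fin.cons (z - w - ∑ j, (v' j + w)) fun j => v' j + w)
  refine ⟨Sum.elim (fun p => if p.2 then f p.1 else 0) 0,
    Prod.ext ?_ (Prod.ext ?_ (funext fun j => ?_))⟩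
  · simp [xnsPlusCokerHom, Fin.sum_univ_succ, f]
  · simp [xnsPlusCokerHom, f]
  · simp [xnsPlusCokerHom, f]

lemma ker_xnsPlusCokerHom (m : ℕ) :
    LinearMap.ker (xnsPlusCokerHom m) = LinearMap.range (xnsPlusMat1 (m + 2)).mulVecLin := by
  apply le_antisymm
  · intro x hx
    obtain ⟨h0, ⟨s, hs⟩, ht⟩ := xnsPlusCokerHom_eq_zero_iff.mp hx
    choose t ht using ht
    let yF : Fin (m + 2) → ℤ := Fin.cons 0 (Fin.cons (s + ∑ j, t j) fun j => -t j)
    let yC' : ℤ := 2 * s - (x (.inr 2) + x (.inr 1) + ∑ i, x (.inl (i, false)) + x (.inr 0))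
    let yA : ℤ := 3 * yC' + 2 * x (.inr 2) + x (.inr 1)
    have hsum : ∑ i, yF i = s := by simp [yF, Fin.sum_univ_succ]
    have hyA : 2 * yA = x (.inl (0, false)) + x (.inl (0, true)) := by
      simp only [yA, yC']
      linarith
    have hu : ∀ i, x (.inl (i, false)) + x (.inl (i, true)) =
        2 * yA - 12 * (m + 2) * yF i := by
      refine Fin.cases ?_ (Fin.cases ?_ fun j => ?_)
      · simp [yF, hyA]
      · have hj : ∑ j : Fin m, (x (.inl (j.succ.succ, false)) + x (.inl (j.succ.succ, true))) =
            m * (2 * yA) + 12 * (m + 2) * ∑ j, t j := by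
          rw [Finset.mul_sum, Finset.sum_congr rfl fun j _ => show _ =
            2 * yA + 12 * (m + 2) * t j by linarith [ht j], Finset.sum_add_distrib]
          simp
        rw [← Finset.sum_add_distrib, Fin.sum_univ_succ, Fin.sum_univ_succ, hj] at h0
        simp only [yF, Fin.cons_succ, Fin.cons_zero]
        linear_combination h0 - (m + 2 : ℤ) * hs - (m + 1 : ℤ) * hyA
      · simp only [yF, Fin.cons_succ]
        linarith [ht j]
    refine ⟨Sum.elim (fun p => if p.2 then yF p.1 else yF p.1 + yA - x (.inl (p.1, false)))
      ![yA, 2 * yC' + x (.inr 2), yC'], ?_⟩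
    rw [Matrix.mulVecLin_apply]
    ext (⟨i, _ | _⟩ | a)
    · rw [xnsPlusMat1_mulVec_E]
      simp
      ring
    · rw [xnsPlusMat1_mulVec_F]
      simp
      linarith [hu i]
    · fin_cases a
      · refine (xnsPlusMat1_mulVec_A _).trans ?_
        simp [Finset.sum_add_distrib, hsum]
        simp only [yA, yC']
        ring
      · refine (xnsPlusMat1_mulVec_C _).trans ?_
        simp [yA]
        ring
      · refine (xnsPlusMat1_mulVec_C' _).trans ?_
        simp
  · rintro _ ⟨y, rfl⟩
    rw [LinearMap.mem_ker, Matrix.mulVecLin_apply, xnsPlusCokerHom_eq_zero_iff]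
    simp only [xnsPlusMat1_mulVec_E, xnsPlusMat1_mulVec_F, xnsPlusMat1_mulVec_A,
      xnsPlusMat1_mulVec_C, xnsPlusMat1_mulVec_C', Finset.sum_add_distrib,
      Finset.sum_sub_distrib, Finset.sum_neg_distrib, ← Finset.mul_sum]
    refine ⟨?_, ⟨∑ i, y (.inl (i, true)) - (m + 2) * y (.inl (0, true)), ?_⟩,
      fun j => ⟨y (.inl (0, true)) - y (.inl (j.succ.succ, true)), ?_⟩⟩
    · simp
      ring
    · simp
      ring
    · push_cast
      ring

/-- The cokernel `ℤ^I / M(ℤ^I)` of the intersection matrix of the minimal regular model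
with normal crossings of `X_ns^+(p)`, `p = 12k+1`, is isomorphic as an abelian group to
`ℤ × ℤ/12 × (ℤ/12k)^(k-2)`. -/
theorem cokernel_XnsPlus_twelve_k_plus_one (k : ℕ) (hk : 2 ≤ k) :
    Nonempty (((XnsPlusIdx1 k → ℤ) ⧸ LinearMap.range (Matrix.mulVecLin (xnsPlusMat1 k))) ≃+
      (ℤ × ZMod 12 × (Fin (k - 2) → ZMod (12 * k)))) := by
  obtain ⟨m, rfl⟩ := Nat.exists_eq_add_of_le' hk
  exact ⟨((Submodule.quotEquivOfEq _ _ (ker_xnsPlusCokerHom m).symm).trans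
    ((xnsPlusCokerHom m).quotKerEquivOfSurjective (xnsPlusCokerHom_surjective m))).toAddEquiv⟩
end

section
/- Let k ≥ 1 be an integer and set N = 2k+4. Index the coordinates of ℤ^N by the set I = {E_1, F_1, …, E_k, F_k, A, G, C, C'}, and let M : I × I → ℤ be the symmetric integer matrix whose only nonzero entries are (together with their transposes): M(E_i, E_i) = −1, M(F_i, F_i) = −(12k+7), M(E_i, F_i) = 1, M(E_i, A) = M(F_i, A) = 1 for each 1 ≤ i ≤ k; M(A, A) = −(k+1), M(A, G) = 1, M(A, C) = 1; M(G, G) = −(6k+3); M(C, C) = −2, M(C, C') = 1; M(C', C') = −2. Then the cokernel ℤ^I / M(ℤ^I) is isomorphic, as an abelian group, to ℤ × (ℤ/6ℤ) × (ℤ/(12k+6)ℤ)^(k−1). -/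
open Matrix

/-- Index type for the components `{E_1, F_1, …, E_k, F_k, A, G, C, C'}`:
`.inl (i, false)` is `E_{i+1}`, `.inl (i, true)` is `F_{i+1}`, and
`.inr 0, .inr 1, .inr 2, .inr 3` are `A, G, C, C'` respectively. -/
abbrev XnsPlusIdx7 (k : ℕ) : Type := (Fin k × Bool) ⊕ Fin 4

/-- The intersection matrix of the special fiber of the minimal regular model with
normal crossings of `X_ns^+(p)` for `p = 12k+7`. -/
def xnsPlusMat7 (k : ℕ) : Matrix (XnsPlusIdx7 k) (XnsPlusIdx7 k) ℤ :=
  fun i j =>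
    match i, j with
    | .inl (i, bi), .inl (j, bj) =>
        if i = j then
          (if bi = bj then (if bi then -(12 * (k : ℤ) + 7) else -1) else 1)
        else 0
    | .inl _, .inr a => if a = 0 then 1 else 0
    | .inr a, .inl _ => if a = 0 then 1 else 0
    | .inr a, .inr b =>
        !![-((k : ℤ) + 1),                   1,  1,  0;
            1,             -(6 * (k : ℤ) + 3),  0,  0;
            1,                               0, -2,  1;
            0,                               0,  1, -2] a b

/-- The coordinatewise form of `xnsPlusMat7 k *ᵥ u`. -/
def xnsPlusAction7 (k : ℕ) (u : XnsPlusIdx7 k → ℤ) : XnsPlusIdx7 k → ℤ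
  | .inl (i, false) => -u (.inl (i, false)) + u (.inl (i, true)) + u (.inr 0)
  | .inl (i, true) =>
      u (.inl (i, false)) - (12 * (k : ℤ) + 7) * u (.inl (i, true)) + u (.inr 0)
  | .inr a =>
      ![(∑ i, (u (.inl (i, false)) + u (.inl (i, true)))) - ((k : ℤ) + 1) * u (.inr 0)
          + u (.inr 1) + u (.inr 2),
        u (.inr 0) - (6 * (k : ℤ) + 3) * u (.inr 1),
        u (.inr 0) - 2 * u (.inr 2) + u (.inr 3),
        u (.inr 2) - 2 * u (.inr 3)] a

theorem xnsPlusMat7_mulVec (k : ℕ) (u : XnsPlusIdx7 k → ℤ) :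
    xnsPlusMat7 k *ᵥ u = xnsPlusAction7 k u := by
  funext x
  rcases x with ⟨i, b⟩ | a
  · cases b <;>
      simp [Matrix.mulVec, dotProduct, xnsPlusMat7, xnsPlusAction7, Fintype.sum_prod_type,
        ite_mul] <;> ring
  · fin_cases a <;>
      simp [Matrix.mulVec, dotProduct, xnsPlusMat7, xnsPlusAction7, Fintype.sum_prod_type,
        Fin.sum_univ_four, Finset.sum_add_distrib] <;> ring

/-- The class of a divisor in `ℤ × ℤ/6 × (ℤ/(12k+6))^(k-1)`, for `k = n + 1`. -/
def xnsPlusClass7 (n : ℕ) :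
    (XnsPlusIdx7 (n + 1) → ℤ) →ₗ[ℤ] ℤ × ZMod 6 × (Fin n → ZMod (12 * (n + 1) + 6)) :=
  AddMonoidHom.toIntLinearMap
    { toFun v :=
        ((6 * (n : ℤ) + 10) * ∑ i, v (.inl (i, false)) + ∑ i, v (.inl (i, true))
            + (6 * (n : ℤ) + 9) * v (.inr 0) + v (.inr 1) + (4 * (n : ℤ) + 6) * v (.inr 2)
            + (2 * (n : ℤ) + 3) * v (.inr 3),
          ((v (.inl (0, false)) + v (.inl (0, true)) + 4 * v (.inr 2) + 2 * v (.inr 3) : ℤ) :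
            ZMod 6),
          fun j => ((v (.inl (j.succ, false)) + v (.inl (j.succ, true))
            - (v (.inl (0, false)) + v (.inl (0, true))) : ℤ) : ZMod (12 * (n + 1) + 6)))
      map_zero' := by ext <;> simp
      map_add' v w := by
        ext
        · simp [Finset.sum_add_distrib]; ring
        · simp; ring
        · simp; ring }

theorem xnsPlusClass7_apply (n : ℕ) (v : XnsPlusIdx7 (n + 1) → ℤ) :
    xnsPlusClass7 n v =
      ((6 * (n : ℤ) + 10) * ∑ i, v (.inl (i, false)) + ∑ i, v (.inl (i, true))
          + (6 * (n : ℤ) + 9) * v (.inr 0) + v (.inr 1) + (4 * (n : ℤ) + 6) * v (.inr 2)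
          + (2 * (n : ℤ) + 3) * v (.inr 3),
        ((v (.inl (0, false)) + v (.inl (0, true)) + 4 * v (.inr 2) + 2 * v (.inr 3) : ℤ) :
          ZMod 6),
        fun j => ((v (.inl (j.succ, false)) + v (.inl (j.succ, true))
          - (v (.inl (0, false)) + v (.inl (0, true))) : ℤ) : ZMod (12 * (n + 1) + 6))) :=
  rfl

theorem xnsPlusClass7_eq_zero_iff (n : ℕ) (v : XnsPlusIdx7 (n + 1) → ℤ) :
    xnsPlusClass7 n v = 0 ↔
      (6 * (n : ℤ) + 10) * ∑ i, v (.inl (i, false)) + ∑ i, v (.inl (i, true))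
          + (6 * (n : ℤ) + 9) * v (.inr 0) + v (.inr 1) + (4 * (n : ℤ) + 6) * v (.inr 2)
          + (2 * (n : ℤ) + 3) * v (.inr 3) = 0 ∧
      (6 : ℤ) ∣ v (.inl (0, false)) + v (.inl (0, true)) + 4 * v (.inr 2) + 2 * v (.inr 3) ∧
      ∀ j : Fin n, 12 * (n : ℤ) + 18 ∣ v (.inl (j.succ, false)) + v (.inl (j.succ, true))
          - (v (.inl (0, false)) + v (.inl (0, true))) := by
  have hn : ((12 * (n + 1) + 6 : ℕ) : ℤ) = 12 * (n : ℤ) + 18 := by push_cast; ring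
  rw [xnsPlusClass7_apply, Prod.mk_eq_zero, Prod.mk_eq_zero, ZMod.intCast_zmod_eq_zero_iff_dvd,
    funext_iff]
  simp only [Pi.zero_apply, ZMod.intCast_zmod_eq_zero_iff_dvd, hn, Nat.cast_ofNat]

theorem xnsPlusClass7_surjective (n : ℕ) : Function.Surjective (xnsPlusClass7 n) := by
  rintro ⟨z, s, d⟩
  obtain ⟨s, rfl⟩ := ZMod.intCast_surjective s
  choose d' hd' using fun j => ZMod.intCast_surjective (d j)
  refine ⟨fun x => match x with
    | .inl (i, false) => 0
    | .inl (i, true) => Fin.cons (α := fun _ => ℤ) s (fun j => d' j + s) i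
    | .inr a => ![0, z - (s + ∑ j, (d' j + s)), 0, 0] a, ?_⟩
  rw [xnsPlusClass7_apply]
  ext
  · simp [Fin.sum_univ_succ]
  · simp
  · simp [hd']

theorem range_xnsPlusMat7 (n : ℕ) :
    LinearMap.range (Matrix.mulVecLin (xnsPlusMat7 (n + 1))) =
      LinearMap.ker (xnsPlusClass7 n) := by
  ext v
  rw [LinearMap.mem_ker, xnsPlusClass7_eq_zero_iff, LinearMap.mem_range]
  simp only [Matrix.mulVecLin_apply, xnsPlusMat7_mulVec]
  constructor
  · rintro ⟨u, rfl⟩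
    refine ⟨?_, ⟨-(2 * (n + 1) + 1) * u (.inl (0, true)) + u (.inr 0) - u (.inr 2), ?_⟩,
      fun j => ⟨u (.inl (0, true)) - u (.inl (j.succ, true)), ?_⟩⟩
    · simp [xnsPlusAction7, Finset.sum_add_distrib, ← Finset.mul_sum]
      ring
    · simp [xnsPlusAction7]
      ring
    · simp [xnsPlusAction7]
      ring
  · rintro ⟨h, ⟨t, ht⟩, hw⟩
    choose w hw using hw
    have hF0 : v (.inl (0, true)) =
        6 * t - 4 * v (.inr 2) - 2 * v (.inr 3) - v (.inl (0, false)) := by linarith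
    have hF (j : Fin n) : v (.inl (j.succ, true)) = (12 * (n : ℤ) + 18) * w j + (6 * t
        - 4 * v (.inr 2) - 2 * v (.inr 3)) - v (.inl (j.succ, false)) := by linarith [hw j]
    obtain ⟨q, hq⟩ : ∃ q, q = ∑ i, v (.inl (i, false)) + t + 2 * ∑ j, w j + v (.inr 0) := ⟨_, rfl⟩
    have hG : v (.inr 1) = 3 * t - 2 * v (.inr 2) - v (.inr 3) - (6 * (n : ℤ) + 9) * q := by
      rw [hq]
      simp only [Fin.sum_univ_succ, hF0, hF, Finset.sum_add_distrib, Finset.sum_sub_distrib,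
        ← Finset.mul_sum, Finset.sum_const, Finset.card_univ, Fintype.card_fin,
        nsmul_eq_mul] at h ⊢
      linarith
    let f : Fin (n + 1) → ℤ := Fin.cons (α := fun _ => ℤ) (-q) (fun j => -q - w j)
    have hf0 : f 0 = -q := rfl
    have hfs (j : Fin n) : f j.succ = -q - w j := rfl
    let c : ℤ := t - v (.inr 2) - v (.inr 3) - (2 * (n : ℤ) + 3) * q
    refine ⟨fun x => match x with
      | .inl (i, false) => f i + v (.inr 1) - v (.inl (i, false))
      | .inl (i, true) => f i
      | .inr a => ![v (.inr 1), 0, v (.inr 3) + 2 * c, c] a, ?_⟩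
    funext x
    rcases x with ⟨i, b⟩ | a
    · cases b
      · simp [xnsPlusAction7]
        ring
      · refine Fin.cases ?_ (fun j => ?_) i
        · simp [xnsPlusAction7, hf0, hG, hF0]
          ring
        · simp [xnsPlusAction7, hfs, hG, hF]
          ring
    · fin_cases a
      · simp [xnsPlusAction7, Fin.sum_univ_succ, hf0, hfs, Finset.sum_add_distrib,
          Finset.sum_sub_distrib, hG, c] at hq ⊢
        linarith
      · simp [xnsPlusAction7]
      · simp [xnsPlusAction7, c, hG]
        ring
      · simp [xnsPlusAction7]

/-- The cokernel `ℤ^I / M(ℤ^I)` of the intersection matrix of the minimal regular model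
with normal crossings of `X_ns^+(p)`, `p = 12k+7`, is isomorphic as an abelian group to
`ℤ × ℤ/6 × (ℤ/(12k+6))^(k-1)`. -/
theorem cokernel_XnsPlus_twelve_k_plus_seven (k : ℕ) (hk : 1 ≤ k) :
    Nonempty (((XnsPlusIdx7 k → ℤ) ⧸ LinearMap.range (Matrix.mulVecLin (xnsPlusMat7 k))) ≃+
      (ℤ × ZMod 6 × (Fin (k - 1) → ZMod (12 * k + 6)))) := by
  obtain ⟨n, rfl⟩ := Nat.exists_eq_add_of_le' hk
  exact ⟨((Submodule.quotEquivOfEq _ _ (range_xnsPlusMat7 n)).trans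
    ((xnsPlusClass7 n).quotKerEquivOfSurjective (xnsPlusClass7_surjective n))).toAddEquiv⟩
end

section
/- Let k ≥ 0 be an integer and set N = 2k+5. Index the coordinates of ℤ^N by the set I = {E_1, F_1, …, E_k, F_k, A, G, D_0, E_0, F_0}, and let M : I × I → ℤ be the symmetric integer matrix whose only nonzero entries are (together with their transposes): M(E_i, E_i) = −1, M(F_i, F_i) = −(12k+11), M(E_i, F_i) = 1, M(E_i, A) = M(F_i, A) = 1 for each 1 ≤ i ≤ k; M(A, A) = −(k+1), M(A, G) = 1, M(A, D_0) = 1; M(G, G) = −(6k+5); M(D_0, D_0) = −2, M(D_0, E_0) = 1, M(D_0, F_0) = 1; M(E_0, E_0) = −2; M(F_0, F_0) = −(4k+4). Then the cokernel ℤ^I / M(ℤ^I) is isomorphic, as an abelian group, to ℤ × (ℤ/2ℤ) × (ℤ/(12k+10)ℤ)^k. -/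
open Matrix

/-- Index type for the components `{E_1, F_1, …, E_k, F_k, A, G, D_0, E_0, F_0}`:
`.inl (i, false)` is `E_{i+1}`, `.inl (i, true)` is `F_{i+1}`, and
`.inr 0, …, .inr 4` are `A, G, D_0, E_0, F_0` respectively. -/
abbrev XnsPlusIdx11 (k : ℕ) : Type := (Fin k × Bool) ⊕ Fin 5

/-- The intersection matrix of the special fiber of the minimal regular model with
normal crossings of `X_ns^+(p)` for `p = 12k+11`. -/
def xnsPlusMat11 (k : ℕ) : Matrix (XnsPlusIdx11 k) (XnsPlusIdx11 k) ℤ :=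
  fun i j =>
    match i, j with
    | .inl (i, bi), .inl (j, bj) =>
        if i = j then
          (if bi = bj then (if bi then -(12 * (k : ℤ) + 11) else -1) else 1)
        else 0
    | .inl _, .inr a => if a = 0 then 1 else 0
    | .inr a, .inl _ => if a = 0 then 1 else 0
    | .inr a, .inr b =>
        !![-((k : ℤ) + 1),                   1,  1,  0,                   0;
            1,             -(6 * (k : ℤ) + 5),  0,  0,                   0;
            1,                               0, -2,  1,                   1;
            0,                               0,  1, -2,                   0;
            0,                               0,  1,  0, -(4 * (k : ℤ) + 4)] a b

/-- The multiplication of a vector by the intersection matrix, one component at a time. -/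
theorem xnsPlusMat11_mulVec (k : ℕ) (y : XnsPlusIdx11 k → ℤ) :
    (∀ i, (xnsPlusMat11 k *ᵥ y) (.inl (i, false)) =
      -y (.inl (i, false)) + y (.inl (i, true)) + y (.inr 0)) ∧
    (∀ i, (xnsPlusMat11 k *ᵥ y) (.inl (i, true)) =
      y (.inl (i, false)) - (12 * k + 11) * y (.inl (i, true)) + y (.inr 0)) ∧
    (xnsPlusMat11 k *ᵥ y) (.inr 0) =
      ∑ i, (y (.inl (i, false)) + y (.inl (i, true))) - (k + 1) * y (.inr 0)
        + y (.inr 1) + y (.inr 2) ∧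
    (xnsPlusMat11 k *ᵥ y) (.inr 1) = y (.inr 0) - (6 * k + 5) * y (.inr 1) ∧
    (xnsPlusMat11 k *ᵥ y) (.inr 2) = y (.inr 0) - 2 * y (.inr 2) + y (.inr 3) + y (.inr 4) ∧
    (xnsPlusMat11 k *ᵥ y) (.inr 3) = y (.inr 2) - 2 * y (.inr 3) ∧
    (xnsPlusMat11 k *ᵥ y) (.inr 4) = y (.inr 2) - (4 * k + 4) * y (.inr 4) := by
  refine ⟨fun i => ?_, fun i => ?_, ?_, ?_, ?_, ?_, ?_⟩ <;>
    simp [Matrix.mulVec, dotProduct, xnsPlusMat11, Fintype.sum_sum_type, Fintype.sum_prod_type,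
      Fin.sum_univ_five, Finset.sum_add_distrib, ite_mul] <;> ring

/-- The homomorphism to `ℤ × ℤ/2 × (ℤ/(12k+10))^k` whose first coordinate is the pairing with
the vector of multiplicities of the components and whose kernel is the range of the
intersection matrix. -/
def xnsPlusCokerMap (k : ℕ) :
    (XnsPlusIdx11 k → ℤ) →ₗ[ℤ] (ℤ × ZMod 2 × (Fin k → ZMod (12 * k + 10))) where
  toFun x :=
    (∑ i, ((6 * k + 6) * x (.inl (i, false)) + x (.inl (i, true))) + (6 * k + 5) * x (.inr 0)
        + x (.inr 1) + (4 * k + 4) * x (.inr 2) + (2 * k + 2) * x (.inr 3) + x (.inr 4),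
      ((x (.inr 3) + x (.inr 4) : ℤ) : ZMod 2),
      fun i => ((x (.inl (i, false)) + x (.inl (i, true)) - 2 * x (.inr 2) - x (.inr 3)
        - 3 * x (.inr 4) : ℤ) : ZMod (12 * k + 10)))
  map_add' x y := by
    refine Prod.ext ?_ (Prod.ext ?_ (funext fun i => ?_))
    · simp only [Pi.add_apply, Prod.fst_add, mul_add, Finset.sum_add_distrib]
      ring
    · simp only [Pi.add_apply, Prod.snd_add, Prod.fst_add]
      push_cast
      ring
    · simp only [Pi.add_apply, Prod.snd_add]
      push_cast
      ring
  map_smul' c x := by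
    refine Prod.ext ?_ (Prod.ext ?_ (funext fun i => ?_))
    · simp only [Pi.smul_apply, Prod.smul_fst, smul_eq_mul, RingHom.id_apply, mul_add,
        Finset.mul_sum, Finset.sum_add_distrib, mul_left_comm c]
    · simp only [Pi.smul_apply, Prod.smul_fst, Prod.smul_snd, smul_eq_mul, RingHom.id_apply]
      rw [zsmul_eq_mul]
      push_cast
      ring
    · simp only [Pi.smul_apply, Prod.smul_snd, smul_eq_mul, RingHom.id_apply]
      rw [zsmul_eq_mul]
      push_cast
      ring

theorem xnsPlusCokerMap_eq_zero_iff {k : ℕ} {x : XnsPlusIdx11 k → ℤ} :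
    xnsPlusCokerMap k x = 0 ↔
      ∑ i, ((6 * k + 6) * x (.inl (i, false)) + x (.inl (i, true))) + (6 * k + 5) * x (.inr 0)
        + x (.inr 1) + (4 * k + 4) * x (.inr 2) + (2 * k + 2) * x (.inr 3) + x (.inr 4) = 0 ∧
      2 ∣ x (.inr 3) + x (.inr 4) ∧
      ∀ i, (12 * k + 10 : ℤ) ∣ x (.inl (i, false)) + x (.inl (i, true)) - 2 * x (.inr 2)
        - x (.inr 3) - 3 * x (.inr 4) := by
  have h2 := ZMod.intCast_zmod_eq_zero_iff_dvd (x (.inr 3) + x (.inr 4)) 2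
  have hn := fun i => ZMod.intCast_zmod_eq_zero_iff_dvd (x (.inl (i, false)) + x (.inl (i, true))
    - 2 * x (.inr 2) - x (.inr 3) - 3 * x (.inr 4)) (12 * k + 10)
  simp only [Nat.cast_add, Nat.cast_mul, Nat.cast_ofNat] at h2 hn
  simp only [← h2, ← hn]
  simp only [xnsPlusCokerMap, LinearMap.coe_mk, AddHom.coe_mk, Prod.ext_iff, funext_iff,
    Prod.fst_zero, Prod.snd_zero, Pi.zero_apply]

theorem xnsPlusCokerMap_mulVec (k : ℕ) (y : XnsPlusIdx11 k → ℤ) :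
    xnsPlusCokerMap k (xnsPlusMat11 k *ᵥ y) = 0 := by
  obtain ⟨hE, hF, hA, hG, hD, hE0, hF0⟩ := xnsPlusMat11_mulVec k y
  rw [xnsPlusCokerMap_eq_zero_iff, hA, hG, hD, hE0, hF0]
  simp only [hE, hF]
  refine ⟨?_, ⟨y (.inr 2) - y (.inr 3) - (2 * k + 2) * y (.inr 4), by ring⟩,
    fun i => ⟨y (.inr 4) - y (.inl (i, true)), by ring⟩⟩
  have h : ∑ i, ((6 * (k : ℤ) + 6) * (-y (.inl (i, false)) + y (.inl (i, true)) + y (.inr 0))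
      + (y (.inl (i, false)) - (12 * k + 11) * y (.inl (i, true)) + y (.inr 0))) =
      -(6 * k + 5) * ∑ i, (y (.inl (i, false)) + y (.inl (i, true)))
        + k * ((6 * k + 7) * y (.inr 0)) := by
    have hk : (k : ℤ) * ((6 * k + 7) * y (.inr 0)) =
        ∑ _i : Fin k, (6 * (k : ℤ) + 7) * y (.inr 0) := by simp
    rw [hk, Finset.mul_sum, ← Finset.sum_add_distrib]
    exact Finset.sum_congr rfl fun i _ => by ring
  rw [h]
  ring

theorem exists_mulVec_eq_of_xnsPlusCokerMap_eq_zero {k : ℕ} {x : XnsPlusIdx11 k → ℤ}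
    (hx : xnsPlusCokerMap k x = 0) : ∃ y, xnsPlusMat11 k *ᵥ y = x := by
  obtain ⟨h0, ⟨s, hs⟩, ht⟩ := xnsPlusCokerMap_eq_zero_iff.1 hx
  choose t ht using ht
  let a : ℤ := x (.inr 2) + s + x (.inr 4)
  let g : ℤ := x (.inr 0) - ∑ i, (a - 2 * t i - x (.inl (i, false))) + (k + 1) * a - x (.inr 4)
  let y : XnsPlusIdx11 k → ℤ := Sum.elim
    (fun i => if i.2 then -t i.1 else a - t i.1 - x (.inl (i.1, false)))
    ![a, g, x (.inr 4), x (.inr 4) - s, 0]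
  have yE (i) : y (.inl (i, false)) = a - t i - x (.inl (i, false)) := by simp [y]
  have yF (i) : y (.inl (i, true)) = -t i := by simp [y]
  have yA : y (.inr 0) = a := rfl
  have yG : y (.inr 1) = g := rfl
  have yD : y (.inr 2) = x (.inr 4) := rfl
  have yE0 : y (.inr 3) = x (.inr 4) - s := rfl
  have yF0 : y (.inr 4) = 0 := rfl
  obtain ⟨hE, hF, hA, hG, hD, hE0, hF0⟩ := xnsPlusMat11_mulVec k y
  simp only [yE, yF, yA, yG, yD, yE0, yF0] at hE hF hA hG hD hE0 hF0
  refine ⟨y, funext ?_⟩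
  rintro (⟨i, _ | _⟩ | j)
  · rw [hE]
    ring
  · rw [hF]
    linear_combination -ht i - hs
  · fin_cases j
    · refine hA.trans ?_
      have h : ∑ i, (a - t i - x (.inl (i, false)) + -t i) =
          ∑ i, (a - 2 * t i - x (.inl (i, false))) :=
        Finset.sum_congr rfl fun i _ => by ring
      rw [h]
      simp only [g]
      ring!
    · refine hG.trans ?_
      have h : ∑ i, ((6 * (k : ℤ) + 6) * x (.inl (i, false)) + x (.inl (i, true))) =
          -(6 * k + 5) * ∑ i, (a - 2 * t i - x (.inl (i, false)))
            + k * ((6 * k + 7) * a) := by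
        have hk : (k : ℤ) * ((6 * k + 7) * a) = ∑ _i : Fin k, (6 * (k : ℤ) + 7) * a := by simp
        rw [hk, Finset.mul_sum, ← Finset.sum_add_distrib]
        refine Finset.sum_congr rfl fun i _ => ?_
        simp only [a]
        linear_combination ht i + hs
      rw [h] at h0
      simp only [g, a] at h0 ⊢
      change _ = x (.inr 1)
      linear_combination -h0 + (2 * k + 2) * hs
    · refine hD.trans ?_
      simp only [a]
      ring!
    · refine hE0.trans ?_
      change _ = x (.inr 3)
      linear_combination -hs
    · refine hF0.trans ?_
      ring!

theorem range_mulVecLin_xnsPlusMat11 (k : ℕ) :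
    LinearMap.range (Matrix.mulVecLin (xnsPlusMat11 k)) = LinearMap.ker (xnsPlusCokerMap k) := by
  ext x
  simp only [LinearMap.mem_range, LinearMap.mem_ker, Matrix.mulVecLin_apply]
  exact ⟨fun ⟨y, hy⟩ => hy ▸ xnsPlusCokerMap_mulVec k y,
    exists_mulVec_eq_of_xnsPlusCokerMap_eq_zero⟩

theorem xnsPlusCokerMap_surjective (k : ℕ) : Function.Surjective (xnsPlusCokerMap k) := by
  rintro ⟨m, u, v⟩
  obtain ⟨u, rfl⟩ := ZMod.intCast_surjective u
  choose w hw using fun i => ZMod.intCast_surjective (v i)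
  refine ⟨Sum.elim (fun i => if i.2 then w i.1 + u else 0)
    ![0, m - ∑ i, (w i + u) - (2 * k + 2) * u, 0, u, 0], ?_⟩
  refine Prod.ext ?_ (Prod.ext ?_ (funext fun i => ?_))
  · simp [xnsPlusCokerMap]
    ring
  · simp [xnsPlusCokerMap]
  · simp [xnsPlusCokerMap, hw]

/-- The cokernel `ℤ^I / M(ℤ^I)` of the intersection matrix of the minimal regular model
with normal crossings of `X_ns^+(p)`, `p = 12k+11`, is isomorphic as an abelian group to
`ℤ × ℤ/2 × (ℤ/(12k+10))^k`. -/
theorem cokernel_XnsPlus_twelve_k_plus_eleven (k : ℕ) :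
    Nonempty (((XnsPlusIdx11 k → ℤ) ⧸ LinearMap.range (Matrix.mulVecLin (xnsPlusMat11 k))) ≃+
      (ℤ × ZMod 2 × (Fin k → ZMod (12 * k + 10)))) :=
  ⟨((Submodule.quotEquivOfEq _ _ (range_mulVecLin_xnsPlusMat11 k)).trans
    ((xnsPlusCokerMap k).quotKerEquivOfSurjective (xnsPlusCokerMap_surjective k))).toAddEquiv⟩
end

section
/- Let k ≥ 0 be an integer. Let M be the symmetric 5×5 integer matrix, with rows and columns indexed by {E, F, A, B, D_0}, given by: row E = (−(12k²+9k+2), k, k, 0, 1), row F = (k, −(12k²+9k+2), k, 0, 1), row A = (k, k, −1, 1, 1), row B = (0, 0, 1, −2, 0), row D_0 = (1, 1, 1, 0, −3). Then the cokernel ℤ^5 / M(ℤ^5) is isomorphic, as an abelian group, to ℤ × (ℤ/(2k+1)(3k+1)ℤ). -/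
open Matrix

/-- The intersection matrix of the special fiber of the minimal regular model with
normal crossings of `X_s(p)` for `p = 12k+5`, in the basis `{E, F, A, B, D_0}`. -/
def xsMat5 (k : ℕ) : Matrix (Fin 5) (Fin 5) ℤ :=
  !![-(12 * (k : ℤ) ^ 2 + 9 * (k : ℤ) + 2), (k : ℤ), (k : ℤ), 0, 1;
     (k : ℤ), -(12 * (k : ℤ) ^ 2 + 9 * (k : ℤ) + 2), (k : ℤ), 0, 1;
     (k : ℤ), (k : ℤ), -1, 1, 1;
     0, 0, 1, -2, 0;
     1, 1, 1, 0, -3]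

/-- The linear form `(6k+2) a + (3k+1) b + (2k+1) d` on the components `A, B, D_0`. -/
def xsForm (k : ℕ) : (Fin 5 → ℤ) →ₗ[ℤ] ℤ :=
  (6 * (k : ℤ) + 2) • LinearMap.proj 2 + (3 * (k : ℤ) + 1) • LinearMap.proj 3 +
    (2 * (k : ℤ) + 1) • LinearMap.proj 4

lemma xsForm_apply (k : ℕ) (x : Fin 5 → ℤ) :
    xsForm k x = (6 * k + 2) * x 2 + (3 * k + 1) * x 3 + (2 * k + 1) * x 4 := by
  simp [xsForm]

/-- The presentation of the cokernel of `xsMat5 k`, sending `E` to `(1, 0)` and `F` to `(1, 1)`. -/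
def xsQuot (k : ℕ) : (Fin 5 → ℤ) →ₗ[ℤ] ℤ × ZMod ((2 * k + 1) * (3 * k + 1)) :=
  LinearMap.prod
    ((LinearMap.proj 0 : (Fin 5 → ℤ) →ₗ[ℤ] ℤ) + LinearMap.proj 1 + (2 : ℤ) • xsForm k)
    ((Int.castAddHom (ZMod ((2 * k + 1) * (3 * k + 1)))).toIntLinearMap.comp
      ((LinearMap.proj 1 : (Fin 5 → ℤ) →ₗ[ℤ] ℤ) + xsForm k))

lemma xsQuot_apply (k : ℕ) (x : Fin 5 → ℤ) :
    xsQuot k x = (x 0 + x 1 + 2 * xsForm k x, ((x 1 + xsForm k x : ℤ) : ZMod _)) := by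
  simp [xsQuot]

lemma xsQuot_surjective (k : ℕ) : Function.Surjective (xsQuot k) := by
  rintro ⟨m, c⟩
  obtain ⟨c, rfl⟩ := ZMod.intCast_surjective c
  refine ⟨![m - c, c, 0, 0, 0], ?_⟩
  simp [xsQuot_apply, xsForm_apply]

lemma mem_ker_xsQuot (k : ℕ) (x : Fin 5 → ℤ) :
    x ∈ LinearMap.ker (xsQuot k) ↔ x 0 + x 1 + 2 * xsForm k x = 0 ∧
      (2 * (k : ℤ) + 1) * (3 * k + 1) ∣ x 1 + xsForm k x := by
  rw [LinearMap.mem_ker, xsQuot_apply, Prod.mk_eq_zero, ZMod.intCast_zmod_eq_zero_iff_dvd]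
  push_cast
  rfl

lemma range_xsMat5 (k : ℕ) :
    LinearMap.range (Matrix.mulVecLin (xsMat5 k)) = LinearMap.ker (xsQuot k) := by
  ext x
  rw [mem_ker_xsQuot, xsForm_apply, LinearMap.mem_range]
  constructor
  · rintro ⟨y, rfl⟩
    simp only [xsMat5, mulVecLin_apply, mulVec, dotProduct, Fin.sum_univ_five, of_apply,
      cons_val]
    exact ⟨by ring, y 0 - y 1, by ring⟩
  · rintro ⟨h, t, ht⟩
    refine ⟨![t, 0, -(6 * (x 2 - k * t) + 3 * x 3 + 2 * (x 4 - t)),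
      -(3 * (x 2 - k * t) + 2 * x 3 + (x 4 - t)), -(2 * (x 2 - k * t) + x 3 + (x 4 - t))], ?_⟩
    ext i
    fin_cases i <;>
      simp [xsMat5, mulVec, dotProduct, Fin.sum_univ_five] <;> linarith

/-- The cokernel `ℤ^5 / M(ℤ^5)` of the intersection matrix of the minimal regular model
with normal crossings of `X_s(p)`, `p = 12k+5`, is isomorphic as an abelian group to
`ℤ × ℤ/(2k+1)(3k+1)`. -/
theorem cokernel_Xs_twelve_k_plus_five (k : ℕ) :
    Nonempty (((Fin 5 → ℤ) ⧸ LinearMap.range (Matrix.mulVecLin (xsMat5 k))) ≃+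
      (ℤ × ZMod ((2 * k + 1) * (3 * k + 1)))) := by
  exact ⟨((Submodule.quotEquivOfEq _ _ (range_xsMat5 k)).trans
    ((xsQuot k).quotKerEquivOfSurjective (xsQuot_surjective k))).toAddEquiv⟩
end

section
/- Let k ≥ 1 be an integer. Let M be the symmetric 5×5 integer matrix, with rows and columns indexed by {E, F, A, B, C}, given by: row E = (−k(12k+1), k, k, 0, 0), row F = (k, −k(12k+1), k, 0, 0), row A = (k, k, −1, 1, 1), row B = (0, 0, 1, −2, 0), row C = (0, 0, 1, 0, −3). Then the cokernel ℤ^5 / M(ℤ^5) is isomorphic, as an abelian group, to ℤ × (ℤ/k(6k+1)ℤ). -/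
open Matrix

/-- The intersection matrix of the special fiber of the minimal regular model with
normal crossings of `X_s(p)` for `p = 12k+1`, in the basis `{E, F, A, B, C}`. -/
def xsMat1 (k : ℕ) : Matrix (Fin 5) (Fin 5) ℤ :=
  !![-((k : ℤ) * (12 * (k : ℤ) + 1)), (k : ℤ), (k : ℤ), 0, 0;
     (k : ℤ), -((k : ℤ) * (12 * (k : ℤ) + 1)), (k : ℤ), 0, 0;
     (k : ℤ), (k : ℤ), -1, 1, 1;
     0, 0, 1, -2, 0;
     0, 0, 1, 0, -3]

/-- The map sending the classes of `E, F` to `(1, 0), (1, 1)` and the classes of `A, B, C` to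
the values forced by the relations. -/
def xsCokernelMap (k : ℕ) : (Fin 5 → ℤ) →+ ℤ × ZMod (k * (6 * k + 1)) where
  toFun v := (v 0 + v 1 + 12 * k * v 2 + 6 * k * v 3 + 4 * k * v 4,
    ((v 1 + 6 * k * v 2 + 3 * k * v 3 + 2 * k * v 4 : ℤ) : ZMod (k * (6 * k + 1))))
  map_zero' := by simp
  map_add' v w := by
    ext
    · simp only [Pi.add_apply, Prod.fst_add]; ring
    · simp only [Pi.add_apply, Prod.snd_add]; push_cast; ring

lemma xsCokernelMap_apply (k : ℕ) (v : Fin 5 → ℤ) :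
    xsCokernelMap k v = (v 0 + v 1 + 12 * k * v 2 + 6 * k * v 3 + 4 * k * v 4,
      ((v 1 + 6 * k * v 2 + 3 * k * v 3 + 2 * k * v 4 : ℤ) : ZMod (k * (6 * k + 1)))) :=
  rfl

lemma xsCokernelMap_surjective (k : ℕ) : Function.Surjective (xsCokernelMap k) := by
  rintro ⟨x, y⟩
  obtain ⟨y, rfl⟩ := ZMod.intCast_surjective y
  exact ⟨![x - y, y, 0, 0, 0], by simp [xsCokernelMap_apply]⟩

lemma xsMat1_mulVec (k : ℕ) (w : Fin 5 → ℤ) :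
    xsMat1 k *ᵥ w = ![-(k * (12 * k + 1)) * w 0 + k * w 1 + k * w 2,
      k * w 0 - k * (12 * k + 1) * w 1 + k * w 2,
      k * w 0 + k * w 1 - w 2 + w 3 + w 4, w 2 - 2 * w 3, w 2 - 3 * w 4] := by
  ext i
  fin_cases i <;> simp [xsMat1, Matrix.mulVec, dotProduct, Fin.sum_univ_five] <;> ring

lemma xsCokernelMap_eq_zero_iff (k : ℕ) (v : Fin 5 → ℤ) :
    xsCokernelMap k v = 0 ↔ ∃ w, xsMat1 k *ᵥ w = v := by
  rw [xsCokernelMap_apply, Prod.mk_eq_zero, ZMod.intCast_zmod_eq_zero_iff_dvd]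
  constructor
  · rintro ⟨h, m, hm⟩
    push_cast at hm
    have h₁ : v 1 = k * (6 * k + 1) * m - 6 * k * v 2 - 3 * k * v 3 - 2 * k * v 4 := by
      linear_combination hm
    have h₀ : v 0 = -(k * (6 * k + 1) * m) - 6 * k * v 2 - 3 * k * v 3 - 2 * k * v 4 := by
      linear_combination h - hm
    refine ⟨![0, -m, 3 * v 3 - 2 * v 4 + 6 * (-k * m - v 3 - v 2),
      v 3 - v 4 + 3 * (-k * m - v 3 - v 2), v 3 - v 4 + 2 * (-k * m - v 3 - v 2)], ?_⟩
    rw [xsMat1_mulVec]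
    ext i
    fin_cases i <;> simp [h₀, h₁] <;> ring
  · rintro ⟨w, rfl⟩
    rw [xsMat1_mulVec]
    refine ⟨by simp; ring, w 0 - w 1, ?_⟩
    simp
    ring

/-- The cokernel `ℤ^5 / M(ℤ^5)` of the intersection matrix of the minimal regular model
with normal crossings of `X_s(p)`, `p = 12k+1`, is isomorphic as an abelian group to
`ℤ × ℤ/k(6k+1)`. -/
theorem cokernel_Xs_twelve_k_plus_one (k : ℕ) (hk : 1 ≤ k) :
    Nonempty (((Fin 5 → ℤ) ⧸ LinearMap.range (Matrix.mulVecLin (xsMat1 k))) ≃+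
      (ℤ × ZMod (k * (6 * k + 1)))) := by
  have hker : LinearMap.range (Matrix.mulVecLin (xsMat1 k)) =
      LinearMap.ker (xsCokernelMap k).toIntLinearMap := by
    ext v
    exact (xsCokernelMap_eq_zero_iff k v).symm
  exact ⟨((Submodule.quotEquivOfEq _ _ hker).trans
    ((xsCokernelMap k).toIntLinearMap.quotKerEquivOfSurjective
      (xsCokernelMap_surjective k))).toAddEquiv⟩
end

section
/- Let k ≥ 0 be an integer. Let M be the symmetric 5×5 integer matrix, with rows and columns indexed by {E, F, A, C, G}, given by: row E = (−(12k²+13k+4), k, k, 0, 1), row F = (k, −(12k²+13k+4), k, 0, 1), row A = (k, k, −1, 1, 1), row C = (0, 0, 1, −3, 0), row G = (1, 1, 1, 0, −2). Then the cokernel ℤ^5 / M(ℤ^5) is isomorphic, as an abelian group, to ℤ × (ℤ/(2k+1)(3k+2)ℤ). -/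
open Matrix

/-- The intersection matrix of the special fiber of the minimal regular model with
normal crossings of `X_s(p)` for `p = 12k+7`, in the basis `{E, F, A, C, G}`
(where `G = D_{-1}`). -/
def xsMat7 (k : ℕ) : Matrix (Fin 5) (Fin 5) ℤ :=
  !![-(12 * (k : ℤ) ^ 2 + 13 * (k : ℤ) + 4), (k : ℤ), (k : ℤ), 0, 1;
     (k : ℤ), -(12 * (k : ℤ) ^ 2 + 13 * (k : ℤ) + 4), (k : ℤ), 0, 1;
     (k : ℤ), (k : ℤ), -1, 1, 1;
     0, 0, 1, -3, 0;
     1, 1, 1, 0, -2]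

/-- The map `ℤ^5 → ℤ × ℤ/(2k+1)(3k+2)` inducing the isomorphism on the cokernel. Its first
component pairs a vector with the multiplicities of the components of the special fiber. -/
def xsCokerMap (k : ℕ) : (Fin 5 → ℤ) →ₗ[ℤ] ℤ × ZMod ((2 * k + 1) * (3 * k + 2)) :=
  AddMonoidHom.toIntLinearMap
    { toFun := fun x =>
        (x 0 + x 1 + (12 * k + 6) * x 2 + (4 * k + 2) * x 3 + (6 * k + 4) * x 4,
          ((x 1 + (6 * k + 3) * x 2 + (2 * k + 1) * x 3 + (3 * k + 2) * x 4 : ℤ) : ZMod _))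
      map_zero' := by simp
      map_add' := fun x y => by
        ext
        · simp only [Pi.add_apply, Prod.mk_add_mk]
          ring
        · simp only [Pi.add_apply, Prod.mk_add_mk]
          push_cast
          ring }

theorem xsCokerMap_apply (k : ℕ) (x : Fin 5 → ℤ) :
    xsCokerMap k x =
      (x 0 + x 1 + (12 * k + 6) * x 2 + (4 * k + 2) * x 3 + (6 * k + 4) * x 4,
        ((x 1 + (6 * k + 3) * x 2 + (2 * k + 1) * x 3 + (3 * k + 2) * x 4 : ℤ) : ZMod _)) :=
  rfl

theorem xsCokerMap_surjective (k : ℕ) : Function.Surjective (xsCokerMap k) := by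
  rintro ⟨a, b⟩
  obtain ⟨b, rfl⟩ := ZMod.intCast_surjective b
  exact ⟨![a - b, b, 0, 0, 0], by simp [xsCokerMap_apply]⟩

theorem range_xsMat7_eq_ker (k : ℕ) :
    LinearMap.range (Matrix.mulVecLin (xsMat7 k)) = LinearMap.ker (xsCokerMap k) := by
  ext x
  rw [LinearMap.mem_ker, xsCokerMap_apply, Prod.mk_eq_zero, ZMod.intCast_zmod_eq_zero_iff_dvd]
  constructor
  · rintro ⟨y, rfl⟩
    simp only [xsMat7, Matrix.mulVecLin_apply, Matrix.mulVec, dotProduct, Fin.sum_univ_five,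
      Matrix.of_apply, Matrix.cons_val]
    refine ⟨by ring, y 0 - y 1, ?_⟩
    push_cast
    ring
  · rintro ⟨h, t, ht⟩
    push_cast at ht
    refine ⟨![0, -t, -3 * (2 * k + 1) * t - 2 * x 3 - 6 * x 2 - 3 * x 4,
      -(2 * k + 1) * t - x 3 - 2 * x 2 - x 4,
      -(3 * k + 2) * t - x 3 - 3 * x 2 - 2 * x 4], ?_⟩
    ext i
    fin_cases i <;>
      simp only [xsMat7, Matrix.mulVecLin_apply, Matrix.mulVec, dotProduct, Fin.sum_univ_five,
        Matrix.of_apply, Matrix.cons_val, Fin.reduceFinMk, Fin.zero_eta, Fin.mk_one]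
    · linear_combination ht - h
    · linear_combination -ht
    all_goals ring

/-- The cokernel `ℤ^5 / M(ℤ^5)` of the intersection matrix of the minimal regular model
with normal crossings of `X_s(p)`, `p = 12k+7`, is isomorphic as an abelian group to
`ℤ × ℤ/(2k+1)(3k+2)`. -/
theorem cokernel_Xs_twelve_k_plus_seven (k : ℕ) :
    Nonempty (((Fin 5 → ℤ) ⧸ LinearMap.range (Matrix.mulVecLin (xsMat7 k))) ≃+
      (ℤ × ZMod ((2 * k + 1) * (3 * k + 2)))) :=
  ⟨((Submodule.quotEquivOfEq _ _ (range_xsMat7_eq_ker k)).trans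
    ((xsCokerMap k).quotKerEquivOfSurjective (xsCokerMap_surjective k))).toAddEquiv⟩
end

section
/- Let k ≥ 0 be an integer and set N = k+4. Index the coordinates of ℤ^N by the set I = {C_1, …, C_k, A, B, D_0, C_0}, and let M : I × I → ℤ be the symmetric integer matrix whose only nonzero entries are (together with their transposes): M(C_i, C_i) = −1, M(C_i, A) = 1, M(C_i, B) = 1 for each 1 ≤ i ≤ k; M(A, A) = −(k+1), M(A, B) = k, M(A, D_0) = 1; M(B, B) = −(12k²+9k+2), M(B, D_0) = 1; M(D_0, D_0) = −2, M(D_0, C_0) = 1; M(C_0, C_0) = −2. Then the cokernel ℤ^I / M(ℤ^I) is isomorphic, as an abelian group, to ℤ; in particular the cokernel is torsion-free. -/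
open Matrix

/-- Index type for the components `{C_1, …, C_k, A, B, D_0, C_0}`:
`.inl i` is `C_{i+1}`, and `.inr 0, .inr 1, .inr 2, .inr 3` are `A, B, D_0, C_0`
respectively. -/
abbrev XsPlusIdx5 (k : ℕ) : Type := Fin k ⊕ Fin 4

/-- The intersection matrix of the special fiber of the minimal regular model with
normal crossings of `X_s^+(p)` for `p = 12k+5`. -/
def xsPlusMat5 (k : ℕ) : Matrix (XsPlusIdx5 k) (XsPlusIdx5 k) ℤ :=
  fun i j =>
    match i, j with
    | .inl i, .inl j => if i = j then -1 else 0
    | .inl _, .inr a => if a = 0 ∨ a = 1 then 1 else 0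
    | .inr a, .inl _ => if a = 0 ∨ a = 1 then 1 else 0
    | .inr a, .inr b =>
        !![-((k : ℤ) + 1), (k : ℤ), 1, 0;
           (k : ℤ), -(12 * (k : ℤ) ^ 2 + 9 * (k : ℤ) + 2), 1, 0;
           1, 1, -2, 1;
           0, 0, 1, -2] a b

/-- The degree map: pairing with the vector of multiplicities of the components. -/
def xsPlusDegree5 (k : ℕ) : (XsPlusIdx5 k → ℤ) →ₗ[ℤ] ℤ :=
  Fintype.linearCombination ℤ
    (Sum.elim (fun _ => 6 * (k : ℤ) + 3) ![6 * k + 2, 1, 4 * k + 2, 2 * k + 1])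

theorem xsPlusDegree5_apply (k : ℕ) (v : XsPlusIdx5 k → ℤ) :
    xsPlusDegree5 k v = (6 * k + 3) * ∑ i, v (.inl i) + (6 * k + 2) * v (.inr 0) + v (.inr 1)
      + (4 * k + 2) * v (.inr 2) + (2 * k + 1) * v (.inr 3) := by
  simp [xsPlusDegree5, Fintype.linearCombination_apply, Fin.sum_univ_four, ← Finset.sum_mul]
  ring

theorem xsPlusMat5_mulVec_inl (k : ℕ) (x : XsPlusIdx5 k → ℤ) (i : Fin k) :
    (xsPlusMat5 k *ᵥ x) (.inl i) = -x (.inl i) + x (.inr 0) + x (.inr 1) := by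
  simp [xsPlusMat5, mulVec, dotProduct, Fin.sum_univ_four]
  ring

theorem xsPlusMat5_mulVec_inr_zero (k : ℕ) (x : XsPlusIdx5 k → ℤ) :
    (xsPlusMat5 k *ᵥ x) (.inr 0) =
      ∑ i, x (.inl i) - (k + 1) * x (.inr 0) + k * x (.inr 1) + x (.inr 2) := by
  simp [xsPlusMat5, mulVec, dotProduct, Fin.sum_univ_four]
  ring

theorem xsPlusMat5_mulVec_inr_one (k : ℕ) (x : XsPlusIdx5 k → ℤ) :
    (xsPlusMat5 k *ᵥ x) (.inr 1) = ∑ i, x (.inl i) + k * x (.inr 0)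
      - (12 * k ^ 2 + 9 * k + 2) * x (.inr 1) + x (.inr 2) := by
  simp [xsPlusMat5, mulVec, dotProduct, Fin.sum_univ_four]
  ring

theorem xsPlusMat5_mulVec_inr_two (k : ℕ) (x : XsPlusIdx5 k → ℤ) :
    (xsPlusMat5 k *ᵥ x) (.inr 2) = x (.inr 0) + x (.inr 1) - 2 * x (.inr 2) + x (.inr 3) := by
  simp [xsPlusMat5, mulVec, dotProduct, Fin.sum_univ_four]
  ring

theorem xsPlusMat5_mulVec_inr_three (k : ℕ) (x : XsPlusIdx5 k → ℤ) :
    (xsPlusMat5 k *ᵥ x) (.inr 3) = x (.inr 2) - 2 * x (.inr 3) := by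
  simp [xsPlusMat5, mulVec, dotProduct, Fin.sum_univ_four]
  ring

theorem xsPlusDegree5_surjective (k : ℕ) : Function.Surjective (xsPlusDegree5 k) := fun n =>
  ⟨Sum.elim 0 ![0, n, 0, 0], by simp [xsPlusDegree5_apply]⟩

theorem range_xsPlusMat5 (k : ℕ) :
    LinearMap.range (xsPlusMat5 k).mulVecLin = LinearMap.ker (xsPlusDegree5 k) := by
  apply le_antisymm
  · rintro _ ⟨x, rfl⟩
    simp only [LinearMap.mem_ker, mulVecLin_apply, xsPlusDegree5_apply, xsPlusMat5_mulVec_inl,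
      xsPlusMat5_mulVec_inr_zero, xsPlusMat5_mulVec_inr_one, xsPlusMat5_mulVec_inr_two,
      xsPlusMat5_mulVec_inr_three, Finset.sum_add_distrib, Finset.sum_neg_distrib,
      Finset.sum_const, Finset.card_univ, Fintype.card_fin, nsmul_eq_mul]
    ring
  · intro v hv
    rw [LinearMap.mem_ker, xsPlusDegree5_apply] at hv
    -- The preimage of `v` whose `B`-coordinate vanishes.
    let S := ∑ i, v (.inl i)
    let d := -(v (.inr 3) + 2 * v (.inr 2) + 2 * S + 2 * v (.inr 0))
    let a := d - S - v (.inr 0)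
    refine ⟨Sum.elim (fun i => a - v (.inl i)) ![a, 0, d, v (.inr 2) + 2 * d - a], ?_⟩
    have hS : ∑ i, (a - v (.inl i)) = k * a - S := by simp [S]
    funext j
    rw [mulVecLin_apply]
    rcases j with i | j
    · simp [xsPlusMat5_mulVec_inl]
    · fin_cases j
      · simp [xsPlusMat5_mulVec_inr_zero, -Finset.sum_sub_distrib, hS]
        ring
      · simp [xsPlusMat5_mulVec_inr_one, -Finset.sum_sub_distrib, hS]
        linear_combination -hv
      · simp [xsPlusMat5_mulVec_inr_two]
      · simp [xsPlusMat5_mulVec_inr_three]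
        ring

/-- The cokernel `ℤ^I / M(ℤ^I)` of the intersection matrix of the minimal regular model
with normal crossings of `X_s^+(p)`, `p = 12k+5`, is isomorphic as an abelian group to
`ℤ`; in particular it is torsion-free. -/
theorem cokernel_XsPlus_twelve_k_plus_five (k : ℕ) :
    Nonempty (((XsPlusIdx5 k → ℤ) ⧸ LinearMap.range (Matrix.mulVecLin (xsPlusMat5 k))) ≃+ ℤ) := by
  exact ⟨((Submodule.quotEquivOfEq _ _ (range_xsPlusMat5 k)).trans
    ((xsPlusDegree5 k).quotKerEquivOfSurjective (xsPlusDegree5_surjective k))).toAddEquiv⟩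
end

section
/- Let k ≥ 1 be an integer and set N = k+4. Index the coordinates of ℤ^N by the set I = {C_1, …, C_k, A, B, C, C'}, and let M : I × I → ℤ be the symmetric integer matrix whose only nonzero entries are (together with their transposes): M(C_i, C_i) = −1, M(C_i, A) = 1, M(C_i, B) = 1 for each 1 ≤ i ≤ k; M(A, A) = −(k+1), M(A, B) = k, M(A, C) = 1; M(B, B) = −(12k²+k); M(C, C) = −2, M(C, C') = 1; M(C', C') = −2. Then the cokernel ℤ^I / M(ℤ^I) is isomorphic, as an abelian group, to ℤ; in particular the cokernel is torsion-free. -/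
open Matrix

/-- Index type for the components `{C_1, …, C_k, A, B, C, C'}`:
`.inl i` is `C_{i+1}`, and `.inr 0, .inr 1, .inr 2, .inr 3` are `A, B, C, C'`
respectively. -/
abbrev XsPlusIdx1 (k : ℕ) : Type := Fin k ⊕ Fin 4

/-- The intersection matrix of the special fiber of the minimal regular model with
normal crossings of `X_s^+(p)` for `p = 12k+1`. -/
def xsPlusMat1 (k : ℕ) : Matrix (XsPlusIdx1 k) (XsPlusIdx1 k) ℤ :=
  fun i j =>
    match i, j with
    | .inl i, .inl j => if i = j then -1 else 0
    | .inl _, .inr a => if a = 0 ∨ a = 1 then 1 else 0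
    | .inr a, .inl _ => if a = 0 ∨ a = 1 then 1 else 0
    | .inr a, .inr b =>
        !![-((k : ℤ) + 1), (k : ℤ), 1, 0;
           (k : ℤ), -(12 * (k : ℤ) ^ 2 + (k : ℤ)), 0, 0;
           1, 0, -2, 1;
           0, 0, 1, -2] a b

/-- The linear form on `ℤ^I` whose coefficients are the multiplicities of the components. -/
def xsPlusMultiplicity (k : ℕ) : (XsPlusIdx1 k → ℤ) →ₗ[ℤ] ℤ :=
  Fintype.linearCombination ℤ
    (Sum.elim (fun _ => 6 * (k : ℤ) + 1) ![6 * (k : ℤ), 1, 4 * (k : ℤ), 2 * (k : ℤ)])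

theorem xsPlusMultiplicity_apply (k : ℕ) (y : XsPlusIdx1 k → ℤ) :
    xsPlusMultiplicity k y = (6 * (k : ℤ) + 1) * (∑ i, y (.inl i)) + 6 * k * y (.inr 0)
      + y (.inr 1) + 4 * k * y (.inr 2) + 2 * k * y (.inr 3) := by
  simp [xsPlusMultiplicity, Fintype.linearCombination_apply, Fin.sum_univ_four, ← Finset.sum_mul]
  ring

theorem xsPlusMat1_mulVec (k : ℕ) (x : XsPlusIdx1 k → ℤ) :
    xsPlusMat1 k *ᵥ x = Sum.elim (fun i => -x (.inl i) + x (.inr 0) + x (.inr 1))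
      ![(∑ i, x (.inl i)) - (k + 1) * x (.inr 0) + k * x (.inr 1) + x (.inr 2),
        (∑ i, x (.inl i)) + k * x (.inr 0) - (12 * (k : ℤ) ^ 2 + k) * x (.inr 1),
        x (.inr 0) - 2 * x (.inr 2) + x (.inr 3),
        x (.inr 2) - 2 * x (.inr 3)] := by
  ext (i | a)
  · simp [mulVec, dotProduct, xsPlusMat1, Fin.sum_univ_four, ite_mul]
    ring
  · fin_cases a <;> simp [mulVec, dotProduct, xsPlusMat1, Fin.sum_univ_four] <;> ring

theorem range_xsPlusMat1 (k : ℕ) :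
    LinearMap.range (xsPlusMat1 k).mulVecLin = LinearMap.ker (xsPlusMultiplicity k) := by
  ext y
  simp only [LinearMap.mem_range, mulVecLin_apply, LinearMap.mem_ker]
  constructor
  · rintro ⟨x, rfl⟩
    rw [xsPlusMultiplicity_apply, xsPlusMat1_mulVec]
    simp [Finset.sum_add_distrib]
    ring
  · intro hy
    rw [xsPlusMultiplicity_apply] at hy
    set S := ∑ i, y (.inl i) with hS
    let a : ℤ := -3 * y (.inr 0) - 3 * S - 2 * y (.inr 2) - y (.inr 3)
    refine ⟨Sum.elim (fun i => a - y (.inl i))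
      ![a, 0, a + y (.inr 0) + S, a + y (.inr 2) + 2 * y (.inr 0) + 2 * S], ?_⟩
    rw [xsPlusMat1_mulVec]
    ext (i | b)
    · simp
    · fin_cases b <;> simp [Finset.sum_sub_distrib, ← hS, a] <;> linarith

theorem xsPlusMultiplicity_surjective (k : ℕ) : Function.Surjective (xsPlusMultiplicity k) :=
  fun n => ⟨Pi.single (.inr 1) n, by simp [xsPlusMultiplicity_apply]⟩

/-- The cokernel `ℤ^I / M(ℤ^I)` of the intersection matrix of the minimal regular model
with normal crossings of `X_s^+(p)`, `p = 12k+1`, is isomorphic as an abelian group to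
`ℤ`; in particular it is torsion-free. -/
theorem cokernel_XsPlus_twelve_k_plus_one (k : ℕ) (hk : 1 ≤ k) :
    Nonempty (((XsPlusIdx1 k → ℤ) ⧸ LinearMap.range (Matrix.mulVecLin (xsPlusMat1 k))) ≃+ ℤ) := by
  exact ⟨((Submodule.quotEquivOfEq _ _ (range_xsPlusMat1 k)).trans
    ((xsPlusMultiplicity k).quotKerEquivOfSurjective
      (xsPlusMultiplicity_surjective k))).toAddEquiv⟩
end
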